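/- For every n and every m, the number of partitions of [n] with exactly m blocks whose canonical sequence avoids the pattern 12112 equals the number of partitions of [n] with exactly m blocks whose canonical sequence avoids the pattern 12212. In particular, the pattern 12112 is equivalent to the pattern 12212, and hence to 12221 and 12122 as well. -/

import Mathlib

/-- `π` is the canonical sequence of a set partition: every entry is at least 1,
and each entry is at most one more than the maximum of the preceding entries
(so the first entry is 1). -/
def IsCanonicalSeq (π : List ℕ) : Prop :=
  ∀ i (h : i < π.length), 1 ≤ π.get ⟨i, h⟩ ∧ π.get ⟨i, h⟩ ≤ (π.take i).foldr max 0 + 1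

/-- `π` contains the pattern `σ`: there is a subsequence of `π`
order-isomorphic to `σ`. -/
def ContainsPat (π σ : List ℕ) : Prop :=
  ∃ f : Fin σ.length → Fin π.length, StrictMono f ∧
    ∀ i j : Fin σ.length, σ.get i < σ.get j ↔ π.get (f i) < π.get (f j)

/-- `π` avoids the pattern `σ`. -/
def AvoidsPat (π σ : List ℕ) : Prop := ¬ ContainsPat π σ

/-- `pAvoid n σ` is the number of canonical sequences of partitions of `[n]`
avoiding the pattern `σ`. -/
noncomputable def pAvoid (n : ℕ) (σ : List ℕ) : ℕ :=
  Set.ncard {π : List ℕ | π.length = n ∧ IsCanonicalSeq π ∧ AvoidsPat π σ}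

/-- Two patterns are equivalent if they have the same number of avoiders of
each size. -/
def PatEquiv (σ σ' : List ℕ) : Prop := ∀ n, pAvoid n σ = pAvoid n σ'

/-- The increasing sequence `1, 2, …, k`. -/
def iota (k : ℕ) : List ℕ := (List.range k).map (· + 1)

theorem append_cons_inj_of_notMem_left {α : Type*} {a : α} {x x' y y' : List α} (h : a ∉ x)
    (h' : a ∉ x') (he : x ++ a :: y = x' ++ a :: y') : x = x' ∧ y = y' := by
  induction x generalizing x' with
  | nil =>
    cases x' with
    | nil => exact ⟨rfl, List.tail_eq_of_cons_eq he⟩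
    | cons c x' => exact (h' (by rw [List.head_eq_of_cons_eq he]; exact List.mem_cons_self)).elim
  | cons b x ih =>
    cases x' with
    | nil => exact (h (by rw [← List.head_eq_of_cons_eq he]; exact List.mem_cons_self)).elim
    | cons c x' =>
      simp only [List.cons_append, List.cons.injEq, List.mem_cons, not_or] at he h h'
      obtain ⟨h1, h2⟩ := ih h.2 h'.2 he.2
      exact ⟨by rw [he.1, h1], h2⟩

/-- The words of length `n` over the alphabet `S`. -/
def wordsOver (S : Finset ℕ) : ℕ → Finset (List ℕ)
  | 0 => {[]}
  | n + 1 => (S ×ˢ wordsOver S n).image fun p => p.1 :: p.2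

theorem mem_wordsOver {S : Finset ℕ} {n : ℕ} {l : List ℕ} :
    l ∈ wordsOver S n ↔ l.length = n ∧ ∀ x ∈ l, x ∈ S := by
  induction n generalizing l with
  | zero => simp +contextual [wordsOver, List.length_eq_zero_iff]
  | succ n ih => cases l <;> simp [wordsOver, ih]; tauto

open Classical in
/-- The number of words of length `n` over `S` satisfying `P`. -/
noncomputable def wordCount (S : Finset ℕ) (P : List ℕ → Prop) (n : ℕ) : ℕ :=
  ((wordsOver S n).filter P).card

theorem wordCount_congr {S : Finset ℕ} {P Q : List ℕ → Prop} {n : ℕ}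
    (h : ∀ l, l.length = n → (∀ x ∈ l, x ∈ S) → (P l ↔ Q l)) :
    wordCount S P n = wordCount S Q n := by
  classical
  unfold wordCount
  congr 1
  apply Finset.filter_congr
  intro l hl
  rw [mem_wordsOver] at hl
  exact h l hl.1 hl.2

theorem wordCount_eq_of_subset {S T : Finset ℕ} {P Q : List ℕ → Prop} {n : ℕ}
    (h : ∀ l, l.length = n → ((∀ x ∈ l, x ∈ S) ∧ P l ↔ (∀ x ∈ l, x ∈ T) ∧ Q l)) :
    wordCount S P n = wordCount T Q n := by
  classical
  unfold wordCount
  congr 1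
  ext l
  simp only [Finset.mem_filter, mem_wordsOver]
  by_cases hl : l.length = n
  · simpa [hl] using h l hl
  · simp [hl]

theorem wordCount_or {S : Finset ℕ} {P Q : List ℕ → Prop} {n : ℕ}
    (h : ∀ l, P l → ¬ Q l) :
    wordCount S (fun l => P l ∨ Q l) n = wordCount S P n + wordCount S Q n := by
  classical
  unfold wordCount
  rw [← Finset.card_union_of_disjoint (Finset.disjoint_filter.2 fun l _ => h l)]
  congr 1
  ext l
  simp only [Finset.mem_filter, Finset.mem_union]
  tauto

theorem wordCount_exists {ι : Type*} {S : Finset ℕ} {P : ι → List ℕ → Prop} {n : ℕ}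
    (I : Finset ι) (h : ∀ i ∈ I, ∀ j ∈ I, ∀ l, P i l → P j l → i = j) :
    wordCount S (fun l => ∃ i ∈ I, P i l) n = ∑ i ∈ I, wordCount S (P i) n := by
  classical
  unfold wordCount
  rw [← Finset.card_biUnion]
  · congr 1
    ext l
    simp only [Finset.mem_filter, Finset.mem_biUnion]
    tauto
  · intro i hi j hj hij
    rw [Function.onFun, Finset.disjoint_filter]
    exact fun l _ h1 h2 => hij (h i hi j hj l h1 h2)

/-- The length generating function of the words over `S` satisfying `P`. -/
noncomputable def wordSeries (S : Finset ℕ) (P : List ℕ → Prop) : PowerSeries ℤ :=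
  PowerSeries.mk fun n => (wordCount S P n : ℤ)

theorem wordSeries_congr {S : Finset ℕ} {P Q : List ℕ → Prop}
    (h : ∀ l, (∀ x ∈ l, x ∈ S) → (P l ↔ Q l)) : wordSeries S P = wordSeries S Q := by
  ext n
  simp only [wordSeries, PowerSeries.coeff_mk]
  rw [wordCount_congr fun l _ => h l]

theorem wordSeries_or {S : Finset ℕ} {P Q : List ℕ → Prop} (h : ∀ l, P l → ¬ Q l) :
    wordSeries S (fun l => P l ∨ Q l) = wordSeries S P + wordSeries S Q := by
  ext n
  simp [wordSeries, wordCount_or h]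

theorem wordSeries_append {S : Finset ℕ} {A B : List ℕ → Prop}
    (h : ∀ x y x' y', A x → A x' → B y → B y' → x ++ y = x' ++ y' → x = x') :
    wordSeries S (fun l => ∃ x y, l = x ++ y ∧ A x ∧ B y) = wordSeries S A * wordSeries S B := by
  classical
  ext n
  rw [PowerSeries.coeff_mul]
  simp only [wordSeries, PowerSeries.coeff_mk]
  norm_cast
  simp only [wordCount, ← Finset.card_product]
  rw [← Finset.card_sigma]
  symm
  refine Finset.card_bij (fun z _ => z.2.1 ++ z.2.2) ?_ ?_ ?_
  · rintro ⟨⟨i, j⟩, x, y⟩ hz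
    simp only [Finset.mem_sigma, Finset.mem_product,
      Finset.mem_filter, mem_wordsOver] at hz
    simp only [Finset.mem_filter, mem_wordsOver, List.length_append, List.mem_append]
    have hij := Finset.HasAntidiagonal.mem_antidiagonal.1 hz.1
    simp only at hij
    exact ⟨⟨by omega, fun z h => h.elim (hz.2.1.1.2 z) (hz.2.2.1.2 z)⟩,
      x, y, rfl, hz.2.1.2, hz.2.2.2⟩
  · rintro ⟨⟨i, j⟩, x, y⟩ hz ⟨⟨i', j'⟩, x', y'⟩ hz' he
    simp only [Finset.mem_sigma, Finset.mem_product,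
      Finset.mem_filter, mem_wordsOver] at hz hz'
    obtain rfl := h x y x' y' hz.2.1.2 hz'.2.1.2 hz.2.2.2 hz'.2.2.2 he
    obtain rfl := List.append_cancel_left he
    obtain ⟨-, ⟨⟨rfl, -⟩, -⟩, ⟨⟨rfl, -⟩, -⟩⟩ := hz
    obtain ⟨-, ⟨⟨rfl, -⟩, -⟩, ⟨⟨rfl, -⟩, -⟩⟩ := hz'
    rfl
  · intro l hl
    simp only [Finset.mem_filter, mem_wordsOver] at hl
    obtain ⟨⟨hn, hS⟩, x, y, rfl, hx, hy⟩ := hl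
    simp only [List.length_append, List.mem_append] at hn hS
    refine ⟨⟨(x.length, y.length), x, y⟩, ?_, rfl⟩
    simp only [Finset.mem_sigma, Finset.mem_product,
      Finset.mem_filter, mem_wordsOver]
    exact ⟨Finset.HasAntidiagonal.mem_antidiagonal.2 hn,
      ⟨⟨trivial, fun z hz => hS z (Or.inl hz)⟩, hx⟩,
      ⟨trivial, fun z hz => hS z (Or.inr hz)⟩, hy⟩

theorem wordSeries_nil {S : Finset ℕ} : wordSeries S (fun l => l = []) = 1 := by
  classical
  ext n
  simp only [wordSeries, PowerSeries.coeff_mk, PowerSeries.coeff_one, wordCount]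
  rcases n with _ | n
  · rw [if_pos rfl, Nat.cast_eq_one, Finset.card_eq_one]
    exact ⟨[], by ext l; simp +contextual [mem_wordsOver]⟩
  · rw [if_neg (by omega), Nat.cast_eq_zero, Finset.card_eq_zero]
    ext l
    suffices l ∈ wordsOver S (n + 1) → l ≠ [] by simpa using this
    rintro h rfl
    simp [mem_wordsOver] at h

/-- The series `X / (1 - X)`. -/
noncomputable def runSeries : PowerSeries ℤ := PowerSeries.mk fun n => if n = 0 then 0 else 1

open PowerSeries in
theorem one_sub_X_mul_runSeries : (1 - X) * runSeries = X := by
  ext n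
  rcases n with _ | _ | n <;>
    simp [sub_mul, PowerSeries.coeff_succ_X_mul, runSeries, PowerSeries.coeff_X]

theorem wordSeries_run {S : Finset ℕ} {a : ℕ} (ha : a ∈ S) :
    wordSeries S (fun l => ∃ k, l = List.replicate (k + 1) a) = runSeries := by
  classical
  ext n
  simp only [wordSeries, runSeries, PowerSeries.coeff_mk, wordCount]
  rcases n with _ | n
  · simp [wordsOver, Finset.filter_singleton, List.replicate_succ]
  · have : (wordsOver S (n + 1)).filter (fun l => ∃ k, l = List.replicate (k + 1) a) =
        {List.replicate (n + 1) a} := by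
      ext l
      simp only [Finset.mem_filter, mem_wordsOver, Finset.mem_singleton]
      constructor
      · rintro ⟨⟨h, -⟩, k, rfl⟩
        simp at h
        rw [h]
      · rintro rfl
        exact ⟨⟨by simp, fun x hx => by rw [List.eq_of_mem_replicate hx]; exact ha⟩, n, rfl⟩
    simp [this]

/-- The Euler operator `X d/dX`. -/
noncomputable def euler (f : PowerSeries ℤ) : PowerSeries ℤ :=
  PowerSeries.X * PowerSeries.derivative ℤ f

theorem coeff_euler (f : PowerSeries ℤ) (n : ℕ) :
    PowerSeries.coeff n (euler f) = n * PowerSeries.coeff n f := by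
  rcases n with _ | n
  · simp [euler]
  · simp [euler, PowerSeries.coeff_succ_X_mul, PowerSeries.coeff_derivative, mul_comm]

/-- Words obtained by inserting `a` directly after some letter of a word `x` free of `a`. -/
theorem wordSeries_insert {S : Finset ℕ} {a : ℕ} (ha : a ∈ S) {A : List ℕ → Prop}
    (hA : ∀ x, A x → a ∉ x) :
    wordSeries S (fun l => ∃ x y, l = x ++ a :: y ∧ x ≠ [] ∧ A (x ++ y)) =
      PowerSeries.X * euler (wordSeries S A) := by
  classical
  ext n
  rcases n with _ | n
  · simp [wordSeries, wordCount, wordsOver, Finset.filter_singleton]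
  rw [PowerSeries.coeff_succ_X_mul, coeff_euler]
  simp only [wordSeries, PowerSeries.coeff_mk, wordCount]
  norm_cast
  rw [← Finset.card_range n, ← Finset.card_product, Finset.card_range]
  symm
  refine Finset.card_bij (fun z _ => z.2.take (z.1 + 1) ++ a :: z.2.drop (z.1 + 1)) ?_ ?_ ?_
  · rintro ⟨j, x⟩ hz
    simp only [Finset.mem_product, Finset.mem_filter, mem_wordsOver, Finset.mem_range] at hz
    obtain ⟨hj, ⟨rfl, hS⟩, hx⟩ := hz
    simp only [Finset.mem_filter, mem_wordsOver]
    refine ⟨⟨by simp; omega, ?_⟩, _, _, rfl, ?_, by simpa using hx⟩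
    · intro z hz
      simp only [List.mem_append, List.mem_cons] at hz
      rcases hz with hz | rfl | hz
      exacts [hS _ (List.mem_of_mem_take hz), ha, hS _ (List.mem_of_mem_drop hz)]
    · refine List.ne_nil_of_length_pos ?_
      simp
      omega
  · rintro ⟨j, x⟩ hz ⟨j', x'⟩ hz' he
    simp only [Finset.mem_product, Finset.mem_filter, mem_wordsOver, Finset.mem_range] at hz hz'
    have h1 : a ∉ x.take (j + 1) := fun h => hA x hz.2.2 (List.mem_of_mem_take h)
    have h2 : a ∉ x'.take (j' + 1) := fun h => hA x' hz'.2.2 (List.mem_of_mem_take h)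
    obtain ⟨h3, h4⟩ := append_cons_inj_of_notMem_left h1 h2 he
    have h5 := congrArg List.length h3
    simp only [List.length_take] at h5
    have : j = j' := by omega
    subst this
    have : x = x' := by rw [← List.take_append_drop (j + 1) x, h3, h4, List.take_append_drop]
    rw [this]
  · intro l hl
    simp only [Finset.mem_filter, mem_wordsOver] at hl
    obtain ⟨⟨hn, hS⟩, x, y, rfl, hx, hy⟩ := hl
    replace hx := List.length_pos_iff.2 hx
    simp only [List.length_append, List.length_cons] at hn
    refine ⟨⟨x.length - 1, x ++ y⟩, ?_, ?_⟩
    · simp only [Finset.mem_product, Finset.mem_filter, mem_wordsOver, Finset.mem_range,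
        List.length_append]
      refine ⟨by omega, ⟨by omega, fun z hz => hS z ?_⟩, hy⟩
      simp only [List.mem_append, List.mem_cons] at hz ⊢
      tauto
    · simp [Nat.sub_add_cancel hx]

/-- The letters of a word in the order of their first occurrences. -/
def firsts : List ℕ → List ℕ
  | [] => []
  | a :: r => a :: (firsts r).filter (· ≠ a)

@[simp]
theorem mem_firsts {r : List ℕ} {x : ℕ} : x ∈ firsts r ↔ x ∈ r := by
  induction r with
  | nil => simp [firsts]
  | cons a r ih =>
    simp only [firsts, List.mem_cons, List.mem_filter, ih, decide_eq_true_eq]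
    tauto

theorem nodup_firsts (r : List ℕ) : (firsts r).Nodup := by
  induction r with
  | nil => simp [firsts]
  | cons a r ih => simpa [firsts] using ih.filter _

theorem firsts_append (x y : List ℕ) :
    firsts (x ++ y) = firsts x ++ (firsts y).filter (· ∉ x) := by
  induction x with
  | nil => simp [firsts]
  | cons a x ih =>
    simp only [List.cons_append, firsts, ih, List.filter_append, List.filter_filter]
    congr 2
    apply List.filter_congr
    simp

theorem firsts_filter (p : ℕ → Bool) (r : List ℕ) :
    firsts (r.filter p) = (firsts r).filter p := by
  induction r with
  | nil => simp [firsts]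
  | cons a r ih =>
    by_cases h : p a
    · simp only [List.filter_cons_of_pos h, firsts, ih, List.filter_filter, Bool.and_comm]
    · simp only [List.filter_cons_of_neg h, firsts, ih, List.filter_filter]
      apply List.filter_congr
      intro x _
      by_cases hx : x = a <;> simp_all

theorem firsts_eq_nil {r : List ℕ} : firsts r = [] ↔ r = [] := by
  cases r <;> simp [firsts]

open Classical in
/-- After the first occurrence of `b`, each letter `a` introduced earlier occurs at most once more,
and not at all if `ρ a b`. -/
def RepeatBound (ρ : ℕ → ℕ → Prop) (r : List ℕ) : Prop :=
  ∀ x b y, r = x ++ b :: y → b ∉ x → ∀ a ∈ x, y.count a ≤ if ρ a b then 0 else 1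

/-- Words satisfying `RepeatBound` whose letters are introduced in the order `o`. -/
def OrderedWord (ρ : ℕ → ℕ → Prop) (o r : List ℕ) : Prop :=
  firsts r = o ∧ RepeatBound ρ r

theorem OrderedWord.mem_iff {ρ : ℕ → ℕ → Prop} {o r : List ℕ} (h : OrderedWord ρ o r) {x : ℕ} :
    x ∈ r ↔ x ∈ o := by
  rw [← h.1, mem_firsts]

theorem RepeatBound.filter {ρ : ℕ → ℕ → Prop} {r : List ℕ} (h : RepeatBound ρ r) (p : ℕ → Bool) :
    RepeatBound ρ (r.filter p) := by
  intro x b y he hb a ha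
  obtain ⟨u, v, rfl, hu, hv⟩ := List.filter_eq_append_iff.1 he
  obtain ⟨v₁, v₂, rfl, hv₁, hpb, hv₂⟩ := List.filter_eq_cons_iff.1 hv
  subst hu hv₂
  rw [List.mem_filter] at ha
  rw [List.count_filter ha.2]
  refine h (u ++ v₁) b v₂ (by simp) ?_ a (List.mem_append_left _ ha.1)
  rw [List.mem_append]
  rintro (hb' | hb')
  · exact hb (List.mem_filter.2 ⟨hb', hpb⟩)
  · exact hv₁ b hb' hpb

theorem repeatBound_append {ρ : ℕ → ℕ → Prop} {x y : List ℕ} (hd : x.Disjoint y) :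
    RepeatBound ρ (x ++ y) ↔ RepeatBound ρ x ∧ RepeatBound ρ y := by
  constructor
  · intro h
    constructor
    · convert h.filter (· ∈ x) using 1
      rw [List.filter_append, List.filter_eq_self.2 (by simp),
        List.filter_eq_nil_iff.2, List.append_nil]
      intro a ha
      simpa using fun h => hd h ha
    · convert h.filter (· ∈ y) using 1
      have h1 : x.filter (· ∈ y) = [] := by
        rw [List.filter_eq_nil_iff]
        intro a ha
        simpa using fun h => hd ha h
      have h2 : y.filter (· ∈ y) = y := List.filter_eq_self.2 (by simp)
      rw [List.filter_append, h1, h2, List.nil_append]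
  · rintro ⟨hx, hy⟩ u b v he hb a ha
    rcases List.append_eq_append_iff.1 he with ⟨u', rfl, hu⟩ | ⟨u', hu, hv⟩
    · rw [List.mem_append, not_or] at hb
      rcases List.mem_append.1 ha with ha | ha
      · have : a ∉ v := fun h => hd ha (by simp [hu, h])
        simp [List.count_eq_zero_of_not_mem this]
      · exact hy u' b v hu hb.2 a ha
    · rcases u' with _ | ⟨c, u'⟩
      · simp only [List.append_nil, List.nil_append] at hu hv
        subst hu
        have : a ∉ v := fun h => hd ha (by simp [← hv, h])
        simp [List.count_eq_zero_of_not_mem this]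
      · simp only [List.cons_append, List.cons.injEq] at hv
        obtain ⟨rfl, rfl⟩ := hv
        have : a ∉ y := fun h => hd (by simp [hu, ha]) h
        rw [List.count_append, List.count_eq_zero_of_not_mem this]
        exact hx u b u' hu hb a ha

theorem orderedWord_nil {ρ : ℕ → ℕ → Prop} {r : List ℕ} : OrderedWord ρ [] r ↔ r = [] := by
  constructor
  · exact fun h => firsts_eq_nil.1 h.1
  · rintro rfl
    exact ⟨rfl, fun x b y h => by simp at h⟩

theorem orderedWord_append {ρ : ℕ → ℕ → Prop} {o s r : List ℕ} (hn : (o ++ s).Nodup)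
    (hs : ∀ b ∈ o, ∀ h ∈ s.head?, ρ b h) :
    OrderedWord ρ (o ++ s) r ↔ ∃ x y, r = x ++ y ∧ OrderedWord ρ o x ∧ OrderedWord ρ s y := by
  have hd : o.Disjoint s := List.disjoint_of_nodup_append hn
  constructor
  · intro h
    rcases s with _ | ⟨c, s⟩
    · exact ⟨r, [], by simp, by simpa using h, orderedWord_nil.2 rfl⟩
    have hc : c ∈ r := h.mem_iff.2 (by simp)
    obtain ⟨x, y, rfl, hx⟩ := List.eq_append_cons_of_mem hc
    have h1 := h.1
    rw [firsts_append, firsts, List.filter_cons_of_pos (by simpa using hx)] at h1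
    obtain ⟨rfl, h3⟩ := append_cons_inj_of_notMem_left (by simpa using hx)
      (fun h => hd h (by simp)) h1
    have hxy : x.Disjoint (c :: y) := by
      intro a ha hay
      rcases List.mem_cons.1 hay with rfl | hay
      · exact hx ha
      · have := h.2 x c y rfl hx a ha
        rw [if_pos (hs a (by simpa using ha) c (by simp)), Nat.le_zero, List.count_eq_zero] at this
        exact this hay
    obtain ⟨h4, h5⟩ := (repeatBound_append hxy).1 h.2
    refine ⟨x, c :: y, rfl, ⟨rfl, h4⟩, ?_, h5⟩
    rw [firsts, ← h3, eq_comm, List.filter_eq_self.2]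
    intro a ha
    simp only [List.mem_filter, mem_firsts] at ha
    simpa using fun h => hxy h (List.mem_cons_of_mem _ ha.1)
  · rintro ⟨x, y, rfl, hx, hy⟩
    have hxy : x.Disjoint y := fun a h1 h2 => hd (hx.mem_iff.1 h1) (hy.mem_iff.1 h2)
    refine ⟨?_, (repeatBound_append hxy).2 ⟨hx.2, hy.2⟩⟩
    rw [firsts_append, hx.1, List.filter_eq_self.2, hy.1]
    intro a ha
    simpa using fun h => hxy h (mem_firsts.1 ha)

theorem exists_replicate_append (a : ℕ) (r : List ℕ) :
    ∃ k z, r = List.replicate k a ++ z ∧ z.head? ≠ some a := by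
  induction r with
  | nil => exact ⟨0, [], by simp⟩
  | cons b r ih =>
    by_cases h : b = a
    · obtain ⟨k, z, rfl, hz⟩ := ih
      exact ⟨k + 1, z, by simp [h, List.replicate_succ], hz⟩
    · exact ⟨0, b :: r, by simp, by simpa⟩

theorem firsts_replicate_append (a k : ℕ) (z : List ℕ) :
    firsts (List.replicate (k + 1) a ++ z) = a :: (firsts z).filter (· ≠ a) := by
  induction k with
  | zero => rfl
  | succ k ih =>
    rw [List.replicate_succ, List.cons_append, firsts, ih]
    simp [List.filter_filter]

theorem orderedWord_cons {ρ : ℕ → ℕ → Prop} {a : ℕ} {c r : List ℕ} (ha : a ∉ c)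
    (hc : ∀ b ∈ c, ¬ ρ a b) :
    OrderedWord ρ (a :: c) r ↔ ∃ k z, r = List.replicate (k + 1) a ++ z ∧
      (OrderedWord ρ c (z.filter (· ≠ a)) ∧ z.count a ≤ 1 ∧ z.head? ≠ some a) := by
  constructor
  · intro h
    obtain ⟨k, z, rfl, hz⟩ := exists_replicate_append a r
    rcases k with _ | k
    · have := h.1
      rcases z with _ | ⟨b, z⟩ <;> simp_all [firsts]
    have h1 := h.1
    rw [firsts_replicate_append, List.cons.injEq] at h1
    refine ⟨k, z, rfl, ⟨by rw [firsts_filter, h1.2], ?_⟩, ?_, hz⟩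
    · convert h.2.filter (· ≠ a) using 1
      simp
    · rcases z with _ | ⟨b, z⟩
      · simp
      · have hb : b ≠ a := by simpa using hz
        have := h.2 (List.replicate (k + 1) a) b z rfl (by simp [hb]) a (by simp)
        rw [List.count_cons_of_ne hb]
        exact this.trans (by split_ifs <;> simp)
  · rintro ⟨k, z, rfl, hz, h1, -⟩
    refine ⟨?_, ?_⟩
    · rw [firsts_replicate_append, ← firsts_filter, hz.1]
    · intro u b v he hb d hd
      rcases u with _ | ⟨e, u⟩
      · simp at hd
      have he' := he
      rw [List.replicate_succ, List.cons_append, List.cons_append, List.cons.injEq] at he'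
      obtain ⟨rfl, -⟩ := he'
      simp only [List.mem_cons, not_or] at hb
      rcases List.append_eq_append_iff.1 he with ⟨u', hu, hz'⟩ | ⟨u', hu, hv⟩
      · have hb' : b ∈ c := hz.mem_iff.1 (by simp [hz', hb.1])
        by_cases hda : d = a
        · subst hda
          rw [if_neg (hc b hb')]
          rw [hz', List.count_append, List.count_cons] at h1
          omega
        · have hd' : d ∈ u' := by
            rw [hu, List.mem_append, List.mem_replicate] at hd
            tauto
          have := hz.2 (u'.filter (· ≠ a)) b (v.filter (· ≠ a))
            (by rw [hz', List.filter_append, List.filter_cons_of_pos (by simpa using hb.1)])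
            (fun h => hb.2 ?_) d (by simp [hd', hda])
          · rwa [List.count_filter (by simpa using hda)] at this
          · have h2 := (List.mem_filter.1 h).1
            have : b ∈ a :: u := by rw [hu]; exact List.mem_append_right _ h2
            simpa [hb.1] using this
      · rcases u' with _ | ⟨e, u'⟩
        · simp only [List.append_nil, List.nil_append] at hu hv
          have hb' : b ∈ c := hz.mem_iff.1 (by simp [← hv, hb.1])
          have hd' : d = a := List.eq_of_mem_replicate (n := k + 1) (by rwa [hu])
          subst hd'
          rw [if_neg (hc b hb')]
          rw [← hv, List.count_cons] at h1
          omega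
        · exfalso
          have : b ∈ List.replicate (k + 1) a := by
            rw [hu]
            simp only [List.cons_append, List.cons.injEq] at hv
            simp [hv.1]
          exact hb.1 (List.eq_of_mem_replicate this)

section

open PowerSeries

theorem euler_X_mul (f : PowerSeries ℤ) : euler (X * f) = X * f + X * euler f := by
  simp only [euler, Derivation.leibniz, smul_eq_mul, PowerSeries.derivative_X]
  ring

theorem euler_mul (f g : PowerSeries ℤ) : euler (f * g) = euler f * g + f * euler g := by
  simp only [euler, Derivation.leibniz, smul_eq_mul]
  ring

theorem euler_add (f g : PowerSeries ℤ) : euler (f + g) = euler f + euler g := by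
  simp only [euler, map_add]
  ring

theorem one_sub_X_mul_euler_runSeries : (1 - X) * euler runSeries = runSeries := by
  have h1 := one_sub_X_mul_runSeries
  have h2 := congrArg euler h1
  rw [sub_mul, one_mul] at h2
  have h3 : euler X = X := by simp [euler]
  have h4 : euler (runSeries - X * runSeries) = euler runSeries - euler (X * runSeries) := by
    simp only [euler, map_sub]
    ring
  rw [h3, h4, euler_X_mul] at h2
  linear_combination h2 - h1

theorem runSeries_euler_identity (f : PowerSeries ℤ) :
    runSeries * (f + euler f) + X * euler (runSeries * (f + euler f)) =
      euler (runSeries * (f + X * euler f)) := by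
  have hX : euler X = X := by simp [euler]
  simp only [euler_mul, euler_add, hX]
  linear_combination -f * one_sub_X_mul_euler_runSeries

/-- The length generating function of the words introducing their letters in the order `o`. -/
noncomputable def orderSeries (S : Finset ℕ) (ρ : ℕ → ℕ → Prop) (o : List ℕ) : PowerSeries ℤ :=
  wordSeries S (OrderedWord ρ o)

theorem orderSeries_nil {S : Finset ℕ} {ρ : ℕ → ℕ → Prop} : orderSeries S ρ [] = 1 := by
  rw [← wordSeries_nil (S := S)]
  exact wordSeries_congr fun l _ => orderedWord_nil

theorem orderSeries_append {S : Finset ℕ} {ρ : ℕ → ℕ → Prop} {o s : List ℕ}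
    (hn : (o ++ s).Nodup) (hs : ∀ b ∈ o, ∀ h ∈ s.head?, ρ b h) :
    orderSeries S ρ (o ++ s) = orderSeries S ρ o * orderSeries S ρ s := by
  have hd : o.Disjoint s := List.disjoint_of_nodup_append hn
  rw [orderSeries, wordSeries_congr fun l _ => orderedWord_append hn hs, wordSeries_append]
  · rfl
  · intro x y x' y' hx hx' hy hy' he
    have key : ∀ x y, OrderedWord ρ o x → OrderedWord ρ s y → (x ++ y).filter (· ∈ o) = x := by
      intro x y hx hy
      rw [List.filter_append, List.filter_eq_self.2, List.filter_eq_nil_iff.2, List.append_nil]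
      · intro a ha
        simpa using fun h => hd h (hy.mem_iff.1 ha)
      · intro a ha
        simpa using hx.mem_iff.1 ha
    rw [← key x y hx hy, he, key x' y' hx' hy']

theorem filter_ne_and_count_le_one_iff {ρ : ℕ → ℕ → Prop} {a : ℕ} {c z : List ℕ} (ha : a ∉ c) :
    (OrderedWord ρ c (z.filter (· ≠ a)) ∧ z.count a ≤ 1 ∧ z.head? ≠ some a) ↔
      (OrderedWord ρ c z ∨ ∃ x y, z = x ++ a :: y ∧ x ≠ [] ∧ OrderedWord ρ c (x ++ y)) := by
  have filter_self : ∀ l : List ℕ, a ∉ l → l.filter (· ≠ a) = l := by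
    intro l hl
    rw [List.filter_eq_self]
    rintro b hb
    rw [decide_eq_true_eq]
    rintro rfl
    exact hl hb
  constructor
  · rintro ⟨h1, h2, h3⟩
    by_cases hz : a ∈ z
    · obtain ⟨x, y, rfl, hx⟩ := List.eq_append_cons_of_mem hz
      have hy : a ∉ y := by
        rw [← List.count_eq_zero]
        simp only [List.count_append, List.count_cons_self] at h2
        omega
      refine Or.inr ⟨x, y, rfl, ?_, ?_⟩
      · rintro rfl
        simp at h3
      · rwa [List.filter_append, List.filter_cons_of_neg (by simp), filter_self _ hx,
          filter_self _ hy] at h1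
    · left
      rwa [filter_self _ hz] at h1
  · rintro (h | ⟨x, y, rfl, hx, h⟩)
    · have hz : a ∉ z := fun h' => ha (h.mem_iff.1 h')
      refine ⟨by rwa [filter_self _ hz],
          by simp [List.count_eq_zero_of_not_mem hz], fun h' => hz ?_⟩
      exact List.mem_of_mem_head? h'
    · have hxy : a ∉ x ++ y := fun h' => ha (h.mem_iff.1 h')
      rw [List.mem_append, not_or] at hxy
      refine ⟨?_, ?_, ?_⟩
      · rwa [List.filter_append, List.filter_cons_of_neg (by simp), filter_self _ hxy.1,
          filter_self _ hxy.2]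
      · simp [List.count_append, List.count_eq_zero_of_not_mem hxy.1,
          List.count_eq_zero_of_not_mem hxy.2]
      · rcases x with _ | ⟨b, x⟩
        · simp at hx
        · simp only [List.mem_cons, not_or] at hxy
          simpa using fun h => hxy.1.1 h.symm

theorem orderSeries_cons {S : Finset ℕ} {ρ : ℕ → ℕ → Prop} {a : ℕ} {c : List ℕ}
    (haS : a ∈ S) (ha : a ∉ c) (hc : ∀ b ∈ c, ¬ ρ a b) :
    orderSeries S ρ (a :: c) =
      runSeries * (orderSeries S ρ c + X * euler (orderSeries S ρ c)) := by
  have hnot : ∀ x, OrderedWord ρ c x → a ∉ x := fun x h h' => ha (h.mem_iff.1 h')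
  have h : ∀ l, (OrderedWord ρ (a :: c) l ↔ ∃ x y, l = x ++ y ∧
      (∃ k, x = List.replicate (k + 1) a) ∧ (OrderedWord ρ c y ∨
        ∃ x y', y = x ++ a :: y' ∧ x ≠ [] ∧ OrderedWord ρ c (x ++ y'))) := by
    intro l
    rw [orderedWord_cons ha hc]
    simp only [filter_ne_and_count_le_one_iff ha]
    constructor
    · rintro ⟨k, z, rfl, h⟩
      exact ⟨_, z, rfl, ⟨k, rfl⟩, h⟩
    · rintro ⟨_, z, rfl, ⟨k, rfl⟩, h⟩
      exact ⟨k, z, rfl, h⟩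
  rw [orderSeries, wordSeries_congr fun l _ => h l, wordSeries_append, wordSeries_run haS,
    wordSeries_or, wordSeries_insert haS hnot]
  · rfl
  · rintro l hl ⟨x, y, rfl, -, -⟩
    exact hnot _ hl (by simp)
  · rintro _ y _ y' ⟨k, rfl⟩ ⟨k', rfl⟩ hy hy' he
    rw [← filter_ne_and_count_le_one_iff ha] at hy hy'
    have key : ∀ k (y : List ℕ), y.head? ≠ some a →
        (List.replicate (k + 1) a ++ y).takeWhile (· = a) = List.replicate (k + 1) a := by
      intro k y hy
      rw [List.takeWhile_append_of_pos (by simp +contextual)]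
      rcases y with _ | ⟨b, y⟩
      · simp
      · rw [List.takeWhile_cons_of_neg (by simpa using hy), List.append_nil]
    rw [← key k y hy.2.2, he, key k' y' hy'.2.2]

theorem sum_orderSeries_insert {S : Finset ℕ} {ρ : ℕ → ℕ → Prop} {m : ℕ} (hm : m ∈ S)
    (o : List ℕ) (hn : o.Nodup) (hS : ∀ a ∈ o, a ∈ S) (hmo : m ∉ o)
    (hl : ∀ a ∈ o, ∀ b ∈ o, ∀ c ∈ o, ρ a b → ¬ ρ a c → ρ c b)
    (h1 : ∀ a ∈ o, ρ m a) (h2 : ∀ a ∈ o, ¬ ρ a m) :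
    ∑ j ∈ Finset.range (o.length + 1), orderSeries S ρ (o.take j ++ m :: o.drop j) =
      runSeries * (orderSeries S ρ o + euler (orderSeries S ρ o)) := by
  classical
  have front : ∀ s : List ℕ, s.Nodup → m ∉ s → (∀ a ∈ s, ρ m a) →
      orderSeries S ρ (m :: s) = runSeries * orderSeries S ρ s := by
    intro s hs hms h
    rw [← List.singleton_append, orderSeries_append, orderSeries_cons hm, orderSeries_nil]
    · simp [euler]
    · simp
    · simp
    · simp [hs, hms]
    · intro b hb a ha
      rw [List.mem_singleton] at hb
      subst hb
      exact h a (List.mem_of_mem_head? ha)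
  induction hk : o.length using Nat.strong_induction_on generalizing o with
  | _ k ih =>
  subst hk
  rcases o with _ | ⟨a, o⟩
  · simp [front, orderSeries_nil, euler]
  obtain ⟨c, s, rfl, hc, hs⟩ : ∃ c s, o = c ++ s ∧ (∀ b ∈ c, ¬ ρ a b) ∧
      ∀ h ∈ s.head?, ρ a h := by
    refine ⟨o.takeWhile (¬ ρ a ·), o.dropWhile (¬ ρ a ·), List.takeWhile_append_dropWhile.symm,
      fun b hb => by simpa using List.mem_takeWhile_imp hb, fun h hh => ?_⟩
    have := List.head?_dropWhile_not (¬ ρ a ·) o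
    rw [Option.mem_def.1 hh] at this
    simpa using this
  simp only [List.nodup_cons, List.nodup_append', List.mem_append, not_or, List.mem_cons] at *
  obtain ⟨⟨hac, has⟩, hnc, hns, hd⟩ := hn
  obtain ⟨hma, hmc, hms⟩ := hmo
  have hcs : ∀ b ∈ c, ∀ h ∈ s.head?, ρ b h := fun b hb h hh =>
    hl a (by simp) h (by simp [List.mem_of_mem_head? hh]) b (by simp [hb]) (hs h hh) (hc b hb)
  have tree : ∀ c s : List ℕ, c.Nodup → s.Nodup → c.Disjoint s → a ∉ c → a ∉ s →
      (∀ b ∈ c, ¬ ρ a b) → (∀ h ∈ s.head?, ρ a h) → (∀ b ∈ c, ∀ h ∈ s.head?, ρ b h) →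
      orderSeries S ρ (a :: (c ++ s)) =
        runSeries * (orderSeries S ρ c + X * euler (orderSeries S ρ c)) * orderSeries S ρ s := by
    intro c s hnc hns hd hac has hc hs hcs
    rw [← List.cons_append, orderSeries_append, orderSeries_cons (hS a (by simp)) hac hc]
    · simp [List.nodup_append', *]
    · intro b hb
      rcases List.mem_cons.1 hb with rfl | hb
      exacts [hs, hcs b hb]
  have ihc := ih c.length (by simp) c hnc (fun b hb => hS b (by simp [hb])) hmc
    (fun x hx y hy z hz => hl x (by simp [hx]) y (by simp [hy]) z (by simp [hz]))
    (fun b hb => h1 b (by simp [hb])) (fun b hb => h2 b (by simp [hb])) rfl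
  have ihs := ih s.length (by simp) s hns (fun b hb => hS b (by simp [hb])) hms
    (fun x hx y hy z hz => hl x (by simp [hx]) y (by simp [hy]) z (by simp [hz]))
    (fun b hb => h1 b (by simp [hb])) (fun b hb => h2 b (by simp [hb])) rfl
  have htree := tree c s hnc hns hd hac has hc hs hcs
  have hlen : (a :: (c ++ s)).length = (c.length + 1) + s.length := by simp; omega
  rw [Finset.sum_range_succ'] at ihs ⊢
  simp only [List.take_zero, List.drop_zero, List.nil_append] at ihs ⊢
  rw [front s hns hms fun b hb => h1 b (by simp [hb])] at ihs
  rw [front _ (by simp [List.nodup_append', *]) (by simp [*]) fun b hb => h1 b (by simpa using hb),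
    hlen, Finset.sum_range_add]
  have e1 : ∑ j ∈ Finset.range (c.length + 1), orderSeries S ρ
      ((a :: (c ++ s)).take (j + 1) ++ m :: (a :: (c ++ s)).drop (j + 1)) =
      (runSeries * (runSeries * (orderSeries S ρ c + euler (orderSeries S ρ c)) +
        X * euler (runSeries * (orderSeries S ρ c + euler (orderSeries S ρ c))))) *
          orderSeries S ρ s := by
    rw [← ihc]
    have esum : ∀ f : ℕ → PowerSeries ℤ, euler (∑ j ∈ Finset.range (c.length + 1), f j) =
        ∑ j ∈ Finset.range (c.length + 1), euler (f j) := by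
      intro f
      simp only [euler, map_sum, Finset.mul_sum]
    rw [esum, Finset.mul_sum, ← Finset.sum_add_distrib, Finset.mul_sum, Finset.sum_mul]
    refine Finset.sum_congr rfl fun j hj => ?_
    have hj' : j ≤ c.length := by simpa [Nat.lt_succ_iff] using hj
    have hmem : ∀ x, x ∈ c.take j ++ m :: c.drop j ↔ x = m ∨ x ∈ c := by
      intro x
      conv_rhs => rw [← List.take_append_drop j c]
      simp only [List.mem_append, List.mem_cons]
      tauto
    have hperm : (c.take j ++ m :: c.drop j).Nodup := by
      rw [List.nodup_middle, List.take_append_drop]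
      simp [hmc, hnc]
    rw [← tree _ s hperm hns]
    · simp [List.take_append, List.drop_append, Nat.sub_eq_zero_of_le hj']
    · intro x hx hxs
      rw [hmem] at hx
      rcases hx with rfl | hx
      exacts [hms hxs, hd hx hxs]
    · rw [hmem]
      simp [Ne.symm hma, hac]
    · exact has
    · intro b hb
      rw [hmem] at hb
      rcases hb with rfl | hb
      exacts [h2 a (by simp), hc b hb]
    · exact hs
    · intro b hb h hh
      rw [hmem] at hb
      rcases hb with rfl | hb
      exacts [h1 h (by simp [List.mem_of_mem_head? hh]), hcs b hb h hh]
  have e2 : ∑ j ∈ Finset.range s.length, orderSeries S ρ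
      ((a :: (c ++ s)).take (c.length + 1 + j + 1) ++
        m :: (a :: (c ++ s)).drop (c.length + 1 + j + 1)) =
      runSeries * (orderSeries S ρ c + X * euler (orderSeries S ρ c)) *
        (runSeries * euler (orderSeries S ρ s)) := by
    have ihs' : ∑ j ∈ Finset.range s.length,
        orderSeries S ρ (s.take (j + 1) ++ m :: s.drop (j + 1)) =
          runSeries * euler (orderSeries S ρ s) := by
      linear_combination ihs
    rw [← ihs', Finset.mul_sum]
    refine Finset.sum_congr rfl fun j hj => ?_
    have hmem : ∀ x, x ∈ s.take (j + 1) ++ m :: s.drop (j + 1) ↔ x = m ∨ x ∈ s := by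
      intro x
      conv_rhs => rw [← List.take_append_drop (j + 1) s]
      simp only [List.mem_append, List.mem_cons]
      tauto
    have hperm : (s.take (j + 1) ++ m :: s.drop (j + 1)).Nodup := by
      rw [List.nodup_middle, List.take_append_drop]
      simp [hms, hns]
    have hhead : (s.take (j + 1) ++ m :: s.drop (j + 1)).head? = s.head? := by
      cases s
      · simp at hj
      · simp
    rw [← tree c _ hnc hperm]
    · have h3 : c.length + 1 + j + 1 - c.length - 1 = j + 1 := by omega
      have h4 : c.length + 1 + j - c.length = j + 1 := by omega
      simp [List.take_append, List.drop_append, h4,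
        List.take_of_length_le (show c.length ≤ c.length + 1 + j by omega),
        List.drop_of_length_le (show c.length ≤ c.length + 1 + j by omega)]
    · intro x hx hxs
      rw [hmem] at hxs
      rcases hxs with rfl | hxs
      exacts [hmc hx, hd hx hxs]
    · exact hac
    · rw [hmem]
      simp [Ne.symm hma, has]
    · exact hc
    · rwa [hhead]
    · rwa [hhead]
  rw [e1, e2, htree, runSeries_euler_identity]
  simp only [euler_mul]
  ring

end

open PowerSeries in
theorem coeff_runSeries_mul (f : PowerSeries ℤ) (t : ℕ) :
    coeff t (runSeries * (f + euler f)) = ∑ s ∈ Finset.range t, ((s : ℤ) + 1) * coeff s f := by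
  induction t with
  | zero => simp [runSeries, PowerSeries.coeff_mul]
  | succ t ih =>
    have h : runSeries * (f + euler f) = X * (runSeries * (f + euler f)) + X * (f + euler f) := by
      linear_combination (f + euler f) * one_sub_X_mul_runSeries
    rw [h, map_add, PowerSeries.coeff_succ_X_mul, PowerSeries.coeff_succ_X_mul, ih,
      Finset.sum_range_succ, map_add, coeff_euler]
    ring

/-- The part of a word preceding the last occurrence of `b` (empty if `b` does not occur). -/
def beforeLast (b : ℕ) : List ℕ → List ℕ
  | [] => []
  | x :: q => if b ∈ q then x :: beforeLast b q else []

theorem exists_eq_beforeLast_append {b : ℕ} {q : List ℕ} (h : b ∈ q) :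
    ∃ q', q = beforeLast b q ++ b :: q' ∧ b ∉ q' := by
  induction q with
  | nil => simp at h
  | cons x q ih =>
    by_cases hq : b ∈ q
    · obtain ⟨q', h1, h2⟩ := ih hq
      refine ⟨q', ?_, h2⟩
      rw [beforeLast, if_pos hq, List.cons_append, ← h1]
    · refine ⟨q, ?_, hq⟩
      have : b = x := by simpa [hq] using h
      rw [beforeLast, if_neg hq, this, List.nil_append]

theorem beforeLast_eq_nil {b : ℕ} {q : List ℕ} (h : b ∉ q) : beforeLast b q = [] := by
  cases q <;> simp_all [beforeLast]

theorem subset_of_mem_beforeLast {a b : ℕ} {q : List ℕ} (h : a ∈ beforeLast b q) : a ∈ q := by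
  by_cases hb : b ∈ q
  · obtain ⟨q', h1, -⟩ := exists_eq_beforeLast_append hb
    rw [h1]
    exact List.mem_append_left _ h
  · simp [beforeLast_eq_nil hb] at h

theorem mem_beforeLast_of_mem_of_notMem {a b c : ℕ} {q : List ℕ} (hc : c ∈ q)
    (hab : a ∈ beforeLast b q) (hac : a ∉ beforeLast c q) : c ∈ beforeLast b q := by
  have hb : b ∈ q := by
    by_contra hb
    simp [beforeLast_eq_nil hb] at hab
  obtain ⟨q₁, h1, -⟩ := exists_eq_beforeLast_append hb
  obtain ⟨q₂, h2, -⟩ := exists_eq_beforeLast_append hc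
  rcases List.append_eq_append_iff.1 (h1.symm.trans h2) with ⟨u, hu, -⟩ | ⟨u, hu, hv⟩
  · rw [hu] at hac
    exact (hac (List.mem_append_left _ hab)).elim
  · rcases u with _ | ⟨d, u⟩
    · rw [hu, List.append_nil] at hab
      exact (hac hab).elim
    · simp only [List.cons_append, List.cons.injEq] at hv
      rw [hu, hv.1]
      simp

theorem sublist_append_iff_two_le_count {a b : ℕ} (hab : a ≠ b) {y q : List ℕ} (hb : b ∈ q) :
    [a, a, b].Sublist (y ++ q) ↔ 2 ≤ y.count a + (beforeLast b q).count a := by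
  obtain ⟨q', h1, h2⟩ := exists_eq_beforeLast_append hb
  have hq : y ++ q = (y ++ beforeLast b q) ++ b :: q' := by rw [List.append_assoc, ← h1]
  rw [hq, ← List.count_append]
  constructor
  · intro h
    obtain ⟨l₁, l₂, hl, h3, h4⟩ := List.sublist_append_iff.1 h
    have key : ∀ l : List ℕ, ¬ (a :: (l ++ [b])).Sublist (b :: q') := by
      intro l hl
      rw [List.cons_sublist_cons'] at hl
      rcases hl with hl | ⟨rfl, -⟩
      · exact h2 (hl.subset (by simp))
      · exact hab rfl
    have hsub : [a, a].Sublist l₁ := by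
      rcases l₁ with _ | ⟨c, _ | ⟨d, l₁⟩⟩
      · simp only [List.nil_append] at hl
        subst hl
        exact (key [a] h4).elim
      · simp only [List.cons_append, List.nil_append, List.cons.injEq] at hl
        obtain ⟨-, rfl⟩ := hl
        exact (key [] h4).elim
      · simp only [List.cons_append, List.cons.injEq] at hl
        obtain ⟨rfl, rfl, -⟩ := hl
        simp
    exact List.replicate_sublist_iff.symm.2 (hsub.trans h3)
  · intro h
    have h3 := List.replicate_sublist_iff.symm.1 h
    exact h3.append (List.singleton_sublist.2 (List.mem_cons_self (a := b) (l := q')))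

/-- The word contains no `abaab` in which `a` is introduced before `b`. -/
def AvoidsAbaab (w : List ℕ) : Prop :=
  ∀ x b y a, w = x ++ b :: y → b ∉ x → a ∈ x → ¬ [a, a, b].Sublist y

theorem pairwise_firsts {R : ℕ → ℕ → Prop} {r : List ℕ} :
    (firsts r).Pairwise R ↔ ∀ x b y, r = x ++ b :: y → b ∉ x → ∀ a ∈ x, R a b := by
  induction r using List.reverseRecOn with
  | nil => simp [firsts]
  | append_singleton r c ih =>
    rw [firsts_append, List.pairwise_append, ih]
    constructor
    · rintro ⟨h1, -, h3⟩ x b y he hb a ha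
      rcases List.eq_nil_or_concat' y with rfl | ⟨y, d, rfl⟩
      · obtain ⟨rfl, h5⟩ := List.append_inj' he rfl
        obtain rfl : c = b := by simpa using h5
        exact h3 a (by simpa using ha) c (by simpa [firsts] using hb)
      · rw [← List.cons_append, ← List.append_assoc] at he
        obtain ⟨rfl, h5⟩ := List.append_inj' he rfl
        exact h1 x b y rfl hb a ha
    · intro h
      refine ⟨fun x b y he => h x b (y ++ [c]) (by simp [he]), ?_, ?_⟩
      · simp only [firsts, List.filter_nil]
        exact List.Pairwise.filter _ (List.pairwise_singleton _ _)
      · intro a ha b hb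
        have hb' : b = c ∧ b ∉ r := by simpa [firsts] using hb
        obtain ⟨rfl, hb'⟩ := hb'
        exact h r b [] rfl hb' a (by simpa using ha)

/-- The constraint on the introduction order `o` of `r` imposed by `AvoidsAbaab (r ++ q)`. -/
def OrderCondition (q o : List ℕ) : Prop :=
  o.Pairwise (fun a b => (beforeLast b q).count a ≤ 1) ∧
    ∀ x b y a, q = x ++ b :: y → b ∉ x → b ∉ o → (a ∈ x ∨ a ∈ o) → ¬ [a, a, b].Sublist y

theorem avoidsAbaab_append {r q : List ℕ} (h : r ⊆ q) :
    AvoidsAbaab (r ++ q) ↔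
      RepeatBound (fun a b => a ∈ beforeLast b q) r ∧ OrderCondition q (firsts r) := by
  have key : ∀ x b y a, r = x ++ b :: y → b ∉ x → a ∈ x → (¬ [a, a, b].Sublist (y ++ q) ↔
      (y.count a ≤ if a ∈ beforeLast b q then 0 else 1) ∧ (beforeLast b q).count a ≤ 1) := by
    intro x b y a he hb ha
    rw [sublist_append_iff_two_le_count (by rintro rfl; exact hb ha) (h (by simp [he] : b ∈ r))]
    have := @List.count_pos_iff _ _ _ a (beforeLast b q)
    split_ifs with h'
    · have := this.2 h'
      omega
    · have : (beforeLast b q).count a = 0 := List.count_eq_zero_of_not_mem h'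
      omega
  rw [OrderCondition, pairwise_firsts]
  constructor
  · intro H
    have H1 : ∀ x b y a, r = x ++ b :: y → b ∉ x → a ∈ x → ¬ [a, a, b].Sublist (y ++ q) :=
      fun x b y a he hb ha => H x b (y ++ q) a (by simp [he]) hb ha
    refine ⟨?_, ?_, ?_⟩
    · intro x b y he hb a ha
      convert ((key x b y a he hb ha).1 (H1 x b y a he hb ha)).1
    · exact fun x b y he hb a ha => ((key x b y a he hb ha).1 (H1 x b y a he hb ha)).2
    · intro x b y a he hb hbr ha
      refine H (r ++ x) b y a (by simp [he]) ?_ ?_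
      · simpa [hb] using hbr
      · simpa [or_comm] using ha
  · rintro ⟨H1, H2, H3⟩ x b y a he hb ha
    rcases List.append_eq_append_iff.1 he with ⟨u, rfl, hu⟩ | ⟨u, hu, hv⟩
    · rw [List.mem_append, not_or] at hb
      exact H3 u b y a hu hb.2 (by simpa using hb.1) (by simpa [or_comm] using ha)
    · rcases u with _ | ⟨c, u⟩
      · simp only [List.append_nil, List.nil_append] at hu hv
        subst hu
        exact H3 [] b y a (by simp [← hv]) (by simp) (by simpa using hb) (by simpa using ha)
      · simp only [List.cons_append, List.cons.injEq] at hv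
        obtain ⟨rfl, rfl⟩ := hv
        refine (key x b u a hu hb ha).2 ⟨?_, H2 x b u hu hb a ha⟩
        convert H1 x b u hu hb a ha

theorem orderCondition_cons {m : ℕ} {q o : List ℕ} (hm : m ∉ q) :
    OrderCondition (m :: q) o ↔ OrderCondition q (o.filter (· ≠ m)) := by
  unfold OrderCondition
  refine and_congr ?_ ?_
  · rw [List.pairwise_filter]
    refine List.Pairwise.iff_of_mem fun {a b} _ _ => ?_
    by_cases hb : b ∈ q
    · have hbm : b ≠ m := fun h => hm (h ▸ hb)
      have : m ∉ beforeLast b q := fun h => hm (subset_of_mem_beforeLast h)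
      rw [beforeLast, if_pos hb]
      by_cases ha : a = m
      · subst ha
        simp [List.count_eq_zero_of_not_mem this]
      · rw [List.count_cons_of_ne (Ne.symm ha)]
        simp [ha, hbm]
    · simp [beforeLast, hb, beforeLast_eq_nil hb]
  · constructor
    · intro H x b y a he hb hbo ha
      have hbm : b ≠ m := fun h => hm (by simp [he, h])
      refine H (m :: x) b y a (by simp [he]) (by simp [hbm, hb]) ?_ ?_
      · simpa [hbm] using hbo
      · simp only [List.mem_filter, List.mem_cons] at ha ⊢
        tauto
    · intro H x b y a he hb hbo ha hsub
      rcases x with _ | ⟨c, x⟩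
      · simp only [List.nil_append, List.cons.injEq] at he
        obtain ⟨rfl, rfl⟩ := he
        exact hm (hsub.subset (by simp))
      · simp only [List.cons_append, List.cons.injEq] at he
        obtain ⟨rfl, rfl⟩ := he
        have ham : a ≠ m := by
          rintro rfl
          exact hm (by simp [hsub.subset (show a ∈ [a, a, b] by simp)])
        simp only [List.mem_cons, not_or] at hb ha
        refine H x b y a rfl hb.2 (fun h => hbo (List.mem_filter.1 h).1) ?_ hsub
        simp only [List.mem_filter, decide_eq_true_eq]
        tauto

/-- The duplicate-free lists with entries in `L`. -/
def nodupLists (L : Finset ℕ) : Finset (List ℕ) :=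
  (Finset.range (L.card + 1)).biUnion fun k => (wordsOver L k).filter List.Nodup

theorem mem_nodupLists {L : Finset ℕ} {o : List ℕ} :
    o ∈ nodupLists L ↔ o.Nodup ∧ ∀ x ∈ o, x ∈ L := by
  simp only [nodupLists, Finset.mem_biUnion, Finset.mem_range, Finset.mem_filter, mem_wordsOver]
  constructor
  · rintro ⟨k, -, ⟨-, h1⟩, h2⟩
    exact ⟨h2, h1⟩
  · rintro ⟨h1, h2⟩
    refine ⟨o.length, ?_, ⟨rfl, h2⟩, h1⟩
    rw [Nat.lt_succ_iff, ← List.toFinset_card_of_nodup h1]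
    exact Finset.card_le_card fun x hx => h2 x (List.mem_toFinset.1 hx)

theorem filter_ne_eq_self {m : ℕ} {l : List ℕ} (h : m ∉ l) : l.filter (· ≠ m) = l := by
  rw [List.filter_eq_self]
  intro b hb
  rw [decide_eq_true_eq]
  rintro rfl
  exact h hb

theorem filter_ne_take_append_drop {m : ℕ} {o : List ℕ} (h : m ∉ o) (j : ℕ) :
    (o.take j ++ m :: o.drop j).filter (· ≠ m) = o := by
  rw [List.filter_append, List.filter_cons_of_neg (by simp), ← List.filter_append,
    List.take_append_drop, filter_ne_eq_self h]

theorem exists_eq_take_append_drop {m : ℕ} {o : List ℕ} (hn : o.Nodup) (h : m ∈ o) :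
    ∃ j < (o.filter (· ≠ m)).length + 1,
      o = (o.filter (· ≠ m)).take j ++ m :: (o.filter (· ≠ m)).drop j := by
  obtain ⟨x, y, rfl, hx⟩ := List.eq_append_cons_of_mem h
  rw [List.nodup_middle, List.nodup_cons] at hn
  have hf : (x ++ m :: y).filter (· ≠ m) = x ++ y := by
    rw [List.filter_append, List.filter_cons_of_neg (by simp), ← List.filter_append,
      filter_ne_eq_self hn.1]
  rw [hf]
  exact ⟨x.length, by simp, by simp⟩

theorem wordCount_avoidsAbaab_cons {L : Finset ℕ} {q : List ℕ} {m : ℕ} (hq : ∀ x, x ∈ q ↔ x ∈ L)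
    (hm : m ∉ L) (t : ℕ) :
    wordCount (insert m L) (fun r => AvoidsAbaab (r ++ m :: q)) t =
      wordCount L (fun r => AvoidsAbaab (r ++ q)) t +
        ∑ s ∈ Finset.range t, (s + 1) * wordCount L (fun r => AvoidsAbaab (r ++ q)) s := by
  classical
  have hmq : m ∉ q := by rwa [hq]
  set ρ : ℕ → ℕ → Prop := fun a b => a ∈ beforeLast b (m :: q) with hρ
  set O := (nodupLists L).filter (OrderCondition q) with hO
  have memO : ∀ o, o ∈ O ↔ (o.Nodup ∧ ∀ x ∈ o, x ∈ L) ∧ OrderCondition q o := fun o => by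
    rw [hO, Finset.mem_filter, mem_nodupLists]
  have hρq : ∀ a b, b ∈ q → (ρ a b ↔ a = m ∨ a ∈ beforeLast b q) := by
    intro a b hb
    simp [hρ, beforeLast, hb]
  have notMem : ∀ o ∈ O, m ∉ o := fun o ho h => hm (((memO o).1 ho).1.2 m h)
  have bound_iff : ∀ r : List ℕ, r ⊆ q →
      (RepeatBound (fun a b => a ∈ beforeLast b q) r ↔ RepeatBound ρ r) := by
    intro r hr
    have : ∀ x b y a, r = x ++ b :: y → a ∈ x → (ρ a b ↔ a ∈ beforeLast b q) := by
      intro x b y a he ha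
      rw [hρq a b (hr (by simp [he])), or_iff_right]
      rintro rfl
      exact hmq (hr (by simp [he, ha]))
    refine forall_congr' fun x => forall_congr' fun b => forall_congr' fun y =>
      forall_congr' fun he => forall_congr' fun hb => forall_congr' fun a =>
      forall_congr' fun ha => ?_
    by_cases h' : a ∈ beforeLast b q <;> simp [this x b y a he ha, h']
  have count_old : ∀ s, wordCount L (fun r => AvoidsAbaab (r ++ q)) s =
      ∑ o ∈ O, wordCount (insert m L) (OrderedWord ρ o) s := by
    intro s
    rw [← wordCount_exists]
    · refine wordCount_eq_of_subset fun r _ => ?_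
      constructor
      · rintro ⟨hr, h⟩
        have hr' : r ⊆ q := fun x hx => (hq x).2 (hr x hx)
        rw [avoidsAbaab_append hr', bound_iff r hr'] at h
        exact ⟨fun x hx => Finset.mem_insert_of_mem (hr x hx), firsts r,
          (memO _).2 ⟨⟨nodup_firsts r, by simpa using hr⟩, h.2⟩, rfl, h.1⟩
      · rintro ⟨-, o, ho, hr⟩
        have hrL : ∀ x ∈ r, x ∈ L := fun x hx => ((memO o).1 ho).1.2 x (hr.mem_iff.1 hx)
        have hr' : r ⊆ q := fun x hx => (hq x).2 (hrL x hx)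
        refine ⟨hrL, ?_⟩
        rw [avoidsAbaab_append hr', bound_iff r hr', hr.1]
        exact ⟨hr.2, ((memO o).1 ho).2⟩
    · exact fun o _ o' _ r h h' => h.1.symm.trans h'.1
  have count_new : wordCount (insert m L) (fun r => AvoidsAbaab (r ++ m :: q)) t =
      ∑ o ∈ O, wordCount (insert m L) (OrderedWord ρ o) t +
        ∑ o ∈ O, ∑ j ∈ Finset.range (o.length + 1),
          wordCount (insert m L) (OrderedWord ρ (o.take j ++ m :: o.drop j)) t := by
    rw [Finset.sum_sigma', ← wordCount_exists, ← wordCount_exists, ← wordCount_or]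
    · refine wordCount_congr fun r _ hr => ?_
      have hr' : r ⊆ m :: q := by
        intro x hx
        simpa [hq] using hr x hx
      rw [avoidsAbaab_append hr', orderCondition_cons hmq]
      have hfO : ∀ h : OrderCondition q ((firsts r).filter (· ≠ m)),
          (firsts r).filter (· ≠ m) ∈ O := by
        intro h
        refine (memO _).2 ⟨⟨(nodup_firsts r).filter _, fun x hx => ?_⟩, h⟩
        simp only [List.mem_filter, mem_firsts, decide_eq_true_eq] at hx
        simpa [hx.2] using hr x hx.1
      constructor
      · rintro ⟨h1, h2⟩
        by_cases hmr : m ∈ r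
        · right
          obtain ⟨j, hj, he⟩ := exists_eq_take_append_drop (nodup_firsts r) (mem_firsts.2 hmr)
          exact ⟨⟨_, j⟩, Finset.mem_sigma.2 ⟨hfO h2, Finset.mem_range.2 hj⟩, he, h1⟩
        · left
          rw [filter_ne_eq_self (by simpa using hmr)] at h2 hfO
          exact ⟨_, hfO h2, rfl, h1⟩
      · rintro (⟨o, ho, h1, h2⟩ | ⟨⟨o, j⟩, ho, h1, h2⟩)
        · refine ⟨h2, ?_⟩
          rw [h1, filter_ne_eq_self (notMem o ho)]
          exact ((memO o).1 ho).2
        · refine ⟨h2, ?_⟩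
          have ho' := (Finset.mem_sigma.1 ho).1
          rw [h1, filter_ne_take_append_drop (notMem o ho')]
          exact ((memO o).1 ho').2
    · rintro r ⟨o, ho, h⟩ ⟨⟨o', j⟩, -, h'⟩
      exact notMem o ho (h.mem_iff.1 (h'.mem_iff.2 (by simp)))
    · rintro ⟨o, j⟩ h ⟨o', j'⟩ h' r hr hr'
      simp only [Finset.mem_sigma, Finset.mem_range] at h h'
      have he : o.take j ++ m :: o.drop j = o'.take j' ++ m :: o'.drop j' := hr.1.symm.trans hr'.1
      have hoo : o = o' := by
        rw [← filter_ne_take_append_drop (notMem o h.1) j, he,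
          filter_ne_take_append_drop (notMem o' h'.1) j']
      subst hoo
      have h1 := append_cons_inj_of_notMem_left
        (fun h2 => notMem o h.1 (List.mem_of_mem_take h2))
        (fun h2 => notMem o h.1 (List.mem_of_mem_take h2)) he
      have h2 := congrArg List.length h1.1
      simp only [List.length_take] at h2
      have : j = j' := by omega
      rw [this]
    · exact fun o _ o' _ r h h' => h.1.symm.trans h'.1
  rw [count_new]
  simp only [count_old]
  congr 1
  simp only [Finset.mul_sum]
  rw [Finset.sum_comm]
  refine Finset.sum_congr rfl fun o ho => ?_
  obtain ⟨⟨hn, hoL⟩, -⟩ := (memO o).1 ho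
  have hoq : ∀ x ∈ o, x ∈ q := fun x hx => (hq x).2 (hoL x hx)
  have h := congrArg (PowerSeries.coeff t) (sum_orderSeries_insert (S := insert m L) (ρ := ρ)
    (Finset.mem_insert_self m L) o hn (fun a ha => Finset.mem_insert_of_mem (hoL a ha))
    (notMem o ho) ?_ ?_ ?_)
  · rw [coeff_runSeries_mul, map_sum] at h
    simp only [orderSeries, wordSeries, PowerSeries.coeff_mk] at h
    exact_mod_cast h
  · exact fun a _ b _ c hc hab hac =>
      mem_beforeLast_of_mem_of_notMem (List.mem_cons_of_mem _ (hoq c hc)) hab hac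
  · exact fun a ha => (hρq m a (hoq a ha)).2 (Or.inl rfl)
  · intro a _
    simp [hρ, beforeLast, hmq]

theorem sublist_of_cons_sublist_append {m : ℕ} {l x w : List ℕ} (hm : m ∉ x)
    (h : (m :: l).Sublist (x ++ w)) : (m :: l).Sublist w := by
  induction x with
  | nil => exact h
  | cons c x ih =>
    simp only [List.mem_cons, not_or] at hm
    rw [List.cons_append, List.cons_sublist_cons'] at h
    rcases h with h | ⟨h, -⟩
    exacts [ih hm.2 h, (hm.1 h).elim]

/-- `e d j` inserts `d + 1` letters `m` into words, with `j` recording a gap of the word, and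
produces exactly the words with a letter `m` that have no subsequence `τ a m` for `a ≠ m`. -/
structure InsertionRule (τ : ℕ → ℕ → List ℕ) (m : ℕ) (e : ℕ → ℕ → List ℕ → List ℕ) : Prop where
  exists_eq : ∀ u, m ∈ u → (∀ a, a ≠ m → ¬ (τ a m).Sublist u) →
    ∃ d j v, m ∉ v ∧ j ≤ v.length ∧ u = e d j v
  filter_eq : ∀ d j v, m ∉ v → (e d j v).filter (· ≠ m) = v
  length_eq : ∀ d j v, (e d j v).length = v.length + d + 1
  avoids : ∀ d j v, m ∉ v → ∀ a, a ≠ m → ¬ (τ a m).Sublist (e d j v)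
  mem : ∀ d j v, m ∈ e d j v
  inj : ∀ d j j' v, m ∉ v → j ≤ v.length → j' ≤ v.length → e d j v = e d j' v → j = j'

theorem filter_ne_replicate (m d : ℕ) : (List.replicate d m).filter (· ≠ m) = [] := by
  simp

theorem take_injOn_of_append_cons {m j j' : ℕ} {v y y' : List ℕ} (hm : m ∉ v)
    (hj : j ≤ v.length) (hj' : j' ≤ v.length)
    (h : v.take j ++ m :: y = v.take j' ++ m :: y') : j = j' := by
  have h1 := congrArg List.length (append_cons_inj_of_notMem_left
    (fun h => hm (List.mem_of_mem_take h)) (fun h => hm (List.mem_of_mem_take h)) h).1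
  simp only [List.length_take] at h1
  omega

theorem insertionRule_contiguous (m : ℕ) : InsertionRule (fun a b => [b, a, b]) m
    (fun d j v => v.take j ++ m :: (List.replicate d m ++ v.drop j)) where
  exists_eq u hu h := by
    obtain ⟨x, y, rfl, hx⟩ := List.eq_append_cons_of_mem hu
    obtain ⟨k, z, rfl, hz⟩ := exists_replicate_append m y
    have hmz : m ∉ z := by
      intro hmz
      rcases z with _ | ⟨b, z⟩
      · simp at hmz
      · have hb : b ≠ m := by simpa using hz
        have hmz' : m ∈ z := by simpa [Ne.symm hb] using hmz
        refine h b hb (List.Sublist.trans ?_ (List.sublist_append_right _ _))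
        refine List.Sublist.cons_cons _ (List.Sublist.trans ?_ (List.sublist_append_right _ _))
        exact List.Sublist.cons_cons _ (List.singleton_sublist.2 hmz')
    exact ⟨k, x.length, x ++ z, by simp [hx, hmz], by simp, by simp⟩
  filter_eq d j v hv := by
    rw [List.filter_append, List.filter_cons_of_neg (by simp), List.filter_append,
      filter_ne_replicate, List.nil_append, ← List.filter_append, List.take_append_drop,
      filter_ne_eq_self hv]
  length_eq d j v := by
    simp
    omega
  avoids d j v hv a ha h := by
    have h1 := sublist_of_cons_sublist_append (fun h => hv (List.mem_of_mem_take h)) h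
    rw [← List.cons_append, ← List.replicate_succ] at h1
    generalize d + 1 = k at h1
    have hz : m ∉ v.drop j := fun h => hv (List.mem_of_mem_drop h)
    induction k with
    | zero => exact hz (h1.subset (by simp))
    | succ k ih =>
      rw [List.replicate_succ, List.cons_append, List.cons_sublist_cons'] at h1
      rcases h1 with h1 | ⟨-, h1⟩
      · exact ih h1
      · have h2 := sublist_of_cons_sublist_append
          (fun h => ha (List.eq_of_mem_replicate h)) h1
        exact hz (h2.subset (by simp))
  mem d j v := by simp
  inj d j j' v hv hj hj' h := take_injOn_of_append_cons hv hj hj' h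

theorem insertionRule_last (m : ℕ) : InsertionRule (fun a b => [b, b, a]) m
    (fun d j v => v.take j ++ m :: (v.drop j ++ List.replicate d m)) where
  exists_eq u hu h := by
    obtain ⟨x, y, rfl, hx⟩ := List.eq_append_cons_of_mem hu
    obtain ⟨z, k, rfl, hz⟩ : ∃ z k, y = z ++ List.replicate k m ∧ m ∉ z := by
      by_cases hy : m ∈ y
      · obtain ⟨z, y, rfl, hz⟩ := List.eq_append_cons_of_mem hy
        refine ⟨z, y.length + 1, ?_, hz⟩
        rw [List.replicate_succ, List.append_cancel_left_eq, List.cons.injEq]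
        refine ⟨rfl, List.eq_replicate_iff.2 ⟨rfl, fun b hb => ?_⟩⟩
        by_contra hbm
        refine h b hbm (List.Sublist.trans ?_ (List.sublist_append_right _ _))
        refine List.Sublist.cons_cons _ (List.Sublist.trans ?_ (List.sublist_append_right _ _))
        exact List.Sublist.cons_cons _ (List.singleton_sublist.2 hb)
      · exact ⟨y, 0, by simp, hy⟩
    exact ⟨k, x.length, x ++ z, by simp [hx, hz], by simp, by simp⟩
  filter_eq d j v hv := by
    rw [List.filter_append, List.filter_cons_of_neg (by simp), List.filter_append,
      filter_ne_replicate, List.append_nil, ← List.filter_append, List.take_append_drop,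
      filter_ne_eq_self hv]
  length_eq d j v := by
    simp
    omega
  avoids d j v hv a ha h := by
    have h1 := sublist_of_cons_sublist_append (fun h => hv (List.mem_of_mem_take h)) h
    have h2 : [m, a].Sublist (v.drop j ++ List.replicate d m) := by
      rw [List.cons_sublist_cons'] at h1
      rcases h1 with h1 | ⟨-, h1⟩
      exacts [(List.sublist_cons_self _ _).trans h1, h1]
    have h3 := sublist_of_cons_sublist_append (fun h => hv (List.mem_of_mem_drop h)) h2
    exact ha (List.eq_of_mem_replicate (h3.subset (show a ∈ [m, a] by simp)))
  mem d j v := by simp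
  inj d j j' v hv hj hj' h := take_injOn_of_append_cons hv hj hj' h

theorem InsertionRule.reverse {τ : ℕ → ℕ → List ℕ} {m : ℕ} {e : ℕ → ℕ → List ℕ → List ℕ}
    (h : InsertionRule τ m e) : InsertionRule (fun a b => (τ a b).reverse) m
      (fun d j v => (e d j v.reverse).reverse) where
  exists_eq u hu ha := by
    obtain ⟨d, j, v, h1, h2, h3⟩ := h.exists_eq u.reverse (by simpa using hu)
      (fun a ham hs => ha a ham (by simpa using hs.reverse))
    exact ⟨d, j, v.reverse, by simpa using h1, by simpa using h2, by simp [← h3]⟩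
  filter_eq d j v hv := by
    rw [List.filter_reverse, h.filter_eq d j _ (by simpa using hv), List.reverse_reverse]
  length_eq d j v := by simp [h.length_eq]
  avoids d j v hv a ha hs := h.avoids d j v.reverse (by simpa using hv) a ha
    (by simpa using hs.reverse)
  mem d j v := by simpa using h.mem d j v.reverse
  inj d j j' v hv hj hj' he := h.inj d j j' v.reverse (by simpa using hv) (by simpa using hj)
    (by simpa using hj') (List.reverse_injective he)

theorem InsertionRule.wordCount_eq {τ : ℕ → ℕ → List ℕ} {m : ℕ} {e : ℕ → ℕ → List ℕ → List ℕ}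
    (h : InsertionRule τ m e) (hτ : ∀ a, m ∈ τ a m) {L : Finset ℕ} (hm : m ∉ L)
    (P : List ℕ → Prop) (t : ℕ) :
    wordCount (insert m L) (fun u => P (u.filter (· ≠ m)) ∧ ∀ a, a ≠ m → ¬ (τ a m).Sublist u) t =
      wordCount L P t + ∑ s ∈ Finset.range t, (s + 1) * wordCount L P s := by
  classical
  have hmem : ∀ v : List ℕ, (∀ x ∈ v, x ∈ L) → m ∉ v := fun v hv h => hm (hv m h)
  have key : ∀ s ∈ Finset.range t, (s + 1) * wordCount L P s =
      ∑ j ∈ Finset.range (s + 1), wordCount (insert m L)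
        (fun u => ∃ v, v.length = s ∧ (∀ x ∈ v, x ∈ L) ∧ P v ∧ u = e (t - s - 1) j v) t := by
    intro s hs
    rw [Finset.mem_range] at hs
    rw [Finset.sum_congr rfl (g := fun _ => wordCount L P s), Finset.sum_const, Finset.card_range,
      smul_eq_mul]
    intro j _
    symm
    unfold wordCount
    refine Finset.card_bij (fun v _ => e (t - s - 1) j v) ?_ ?_ ?_
    · intro v hv
      simp only [Finset.mem_filter, mem_wordsOver] at hv ⊢
      obtain ⟨⟨rfl, hL⟩, hP⟩ := hv
      refine ⟨⟨by rw [h.length_eq]; omega, fun x hx => ?_⟩, v, rfl, hL, hP, rfl⟩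
      by_cases hxm : x = m
      · simp [hxm]
      · have : x ∈ (e (t - v.length - 1) j v).filter (· ≠ m) := by simp [hx, hxm]
        rw [h.filter_eq _ _ _ (hmem v hL)] at this
        exact Finset.mem_insert_of_mem (hL x this)
    · intro v hv v' hv' he
      simp only [Finset.mem_filter, mem_wordsOver] at hv hv'
      rw [← h.filter_eq (t - s - 1) j v (hmem v hv.1.2), he, h.filter_eq _ _ _ (hmem v' hv'.1.2)]
    · intro u hu
      simp only [Finset.mem_filter] at hu
      obtain ⟨-, v, hv, hL, hP, rfl⟩ := hu
      exact ⟨v, by simp [mem_wordsOver, hv, hP]; exact hL, rfl⟩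
  rw [Finset.sum_congr rfl key, Finset.sum_sigma', ← wordCount_exists]
  · have hold : wordCount L P t = wordCount (insert m L) (fun u => m ∉ u ∧ P u) t := by
      refine wordCount_eq_of_subset fun u _ => ?_
      constructor
      · rintro ⟨h1, h2⟩
        exact ⟨fun x hx => Finset.mem_insert_of_mem (h1 x hx), hmem u h1, h2⟩
      · rintro ⟨h1, h2, h3⟩
        refine ⟨fun x hx => (Finset.mem_insert.1 (h1 x hx)).resolve_left ?_, h3⟩
        rintro rfl
        exact h2 hx
    rw [hold, ← wordCount_or]
    · refine wordCount_congr fun u hut huS => ?_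
      constructor
      · rintro ⟨h1, h2⟩
        by_cases hmu : m ∈ u
        · right
          obtain ⟨d, j, v, h3, h4, rfl⟩ := h.exists_eq u hmu h2
          rw [h.length_eq] at hut
          rw [h.filter_eq _ _ _ h3] at h1
          refine ⟨⟨v.length, j⟩, ?_, v, rfl, fun x hx => ?_, h1, ?_⟩
          · simp only [Finset.mem_sigma, Finset.mem_range]
            omega
          · have : x ∈ (e d j v).filter (· ≠ m) := by rwa [h.filter_eq _ _ _ h3]
            refine (Finset.mem_insert.1 (huS x (List.mem_filter.1 this).1)).resolve_left ?_
            rintro rfl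
            exact h3 hx
          · have : t - v.length - 1 = d := by omega
            simp only [this]
        · left
          rw [filter_ne_eq_self hmu] at h1
          exact ⟨hmu, h1⟩
      · rintro (⟨h1, h2⟩ | ⟨⟨s, j⟩, -, v, -, hL, hP, rfl⟩)
        · refine ⟨by rwa [filter_ne_eq_self h1], fun a _ hs => h1 (hs.subset (hτ a))⟩
        · exact ⟨by rwa [h.filter_eq _ _ _ (hmem v hL)], h.avoids _ _ _ (hmem v hL)⟩
    · rintro u ⟨h1, -⟩ ⟨_, -, v, -, -, -, rfl⟩
      exact h1 (h.mem _ _ _)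
  · rintro ⟨s, j⟩ hi ⟨s', j'⟩ hi' u ⟨v, rfl, hL, -, rfl⟩ ⟨v', rfl, hL', -, he⟩
    simp only [Finset.mem_sigma, Finset.mem_range] at hi hi' he
    have hv : v = v' := by
      rw [← h.filter_eq (t - v.length - 1) j v (hmem v hL), he, h.filter_eq _ _ _ (hmem v' hL')]
    subst hv
    rw [h.inj _ _ _ _ (hmem v hL) (by omega) (by omega) he]

/-- The word has no subsequence `a, b, τ a b` with `a < b`. -/
def AvoidsPair (τ : ℕ → ℕ → List ℕ) (w : List ℕ) : Prop :=
  ∀ a b, a < b → ¬ (a :: b :: τ a b).Sublist w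

theorem avoidsPair_append_cons {τ : ℕ → ℕ → List ℕ} (hτ : ∀ a b x, x ∈ τ a b ↔ x = a ∨ x = b)
    {L : Finset ℕ} {p u : List ℕ} {m : ℕ} (hp : ∀ x, x ∈ p ↔ x ∈ L) (hm : ∀ x ∈ L, x < m)
    (hu : ∀ x ∈ u, x ∈ insert m L) :
    AvoidsPair τ (p ++ m :: u) ↔
      AvoidsPair τ (p ++ u.filter (· ≠ m)) ∧ ∀ a, a ≠ m → ¬ (τ a m).Sublist u := by
  have hmp : m ∉ p := fun h => lt_irrefl _ (hm m ((hp m).1 h))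
  have hf : (p ++ m :: u).filter (· ≠ m) = p ++ u.filter (· ≠ m) := by
    rw [List.filter_append, filter_ne_eq_self hmp, List.filter_cons_of_neg (by simp)]
  rw [← hf]
  constructor
  · intro h
    refine ⟨fun a b hab hs => h a b hab (hs.trans List.filter_sublist), fun a ha hs => ?_⟩
    have haL : a ∈ L :=
      (Finset.mem_insert.1 (hu a (hs.subset ((hτ a m a).2 (Or.inl rfl))))).resolve_left ha
    have h1 : [a].Sublist p := List.singleton_sublist.2 ((hp a).2 haL)
    exact h a m (hm a haL) (h1.append (List.Sublist.cons_cons m hs))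
  · rintro ⟨h1, h2⟩ a b hab hs
    have hle : ∀ x ∈ p ++ m :: u, x ≤ m := by
      intro x hx
      simp only [List.mem_append, List.mem_cons, hp] at hx
      rcases hx with hx | rfl | hx
      · exact (hm x hx).le
      · exact le_rfl
      · rcases Finset.mem_insert.1 (hu x hx) with rfl | hx
        exacts [le_rfl, (hm x hx).le]
    have hbm := hle b (hs.subset (by simp))
    have ham : a ≠ m := by omega
    rcases hbm.eq_or_lt with rfl | hbm
    · refine h2 a ham ?_
      have h3 := sublist_of_cons_sublist_append hmp ((List.sublist_cons_self _ _).trans hs)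
      rw [List.cons_sublist_cons'] at h3
      rcases h3 with h3 | ⟨-, h3⟩
      exacts [(List.sublist_cons_self _ _).trans h3, h3]
    · refine h1 a b hab ?_
      have h3 := hs.filter (· ≠ m)
      rwa [List.filter_eq_self.2] at h3
      intro x hx
      simp only [List.mem_cons, hτ] at hx
      rw [decide_eq_true_eq]
      omega

theorem InsertionRule.wordCount_avoidsPair {τ : ℕ → ℕ → List ℕ} {m : ℕ}
    {e : ℕ → ℕ → List ℕ → List ℕ} (h : InsertionRule τ m e)
    (hτ : ∀ a b x, x ∈ τ a b ↔ x = a ∨ x = b) {L : Finset ℕ} {p : List ℕ}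
    (hp : ∀ x, x ∈ p ↔ x ∈ L) (hm : ∀ x ∈ L, x < m) (t : ℕ) :
    wordCount (insert m L) (fun u => AvoidsPair τ (p ++ m :: u)) t =
      wordCount L (fun u => AvoidsPair τ (p ++ u)) t +
        ∑ s ∈ Finset.range t, (s + 1) * wordCount L (fun u => AvoidsPair τ (p ++ u)) s := by
  rw [← h.wordCount_eq (fun a => (hτ a m m).2 (Or.inr rfl)) (fun h => lt_irrefl _ (hm m h))]
  exact wordCount_congr fun u _ hu => avoidsPair_append_cons hτ hp hm hu

theorem sum_wordCount_append (S : Finset ℕ) (P : List ℕ → Prop) (i t : ℕ) :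
    ∑ v ∈ wordsOver S i, wordCount S (fun u => P (v ++ u)) t = wordCount S P (i + t) := by
  classical
  unfold wordCount
  rw [← Finset.card_sigma]
  refine Finset.card_bij (fun z _ => z.1 ++ z.2) ?_ ?_ ?_
  · rintro ⟨v, u⟩ hz
    simp only [Finset.mem_sigma, Finset.mem_filter, mem_wordsOver] at hz ⊢
    refine ⟨⟨by simp [hz.1.1, hz.2.1.1], fun x hx => ?_⟩, hz.2.2⟩
    rcases List.mem_append.1 hx with hx | hx
    exacts [hz.1.2 x hx, hz.2.1.2 x hx]
  · rintro ⟨v, u⟩ hz ⟨v', u'⟩ hz' he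
    simp only [Finset.mem_sigma, Finset.mem_filter, mem_wordsOver] at hz hz'
    obtain ⟨rfl, rfl⟩ := List.append_inj he (by rw [hz.1.1, hz'.1.1])
    rfl
  · intro w hw
    simp only [Finset.mem_filter, mem_wordsOver] at hw
    obtain ⟨⟨hn, hS⟩, hP⟩ := hw
    refine ⟨⟨w.take i, w.drop i⟩, ?_, List.take_append_drop i w⟩
    simp only [Finset.mem_sigma, Finset.mem_filter, mem_wordsOver, List.take_append_drop]
    exact ⟨⟨by simp; omega, fun x hx => hS x (List.mem_of_mem_take hx)⟩,
      ⟨by simp; omega, fun x hx => hS x (List.mem_of_mem_drop hx)⟩, hP⟩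

theorem firsts_eq_range'_succ {K : ℕ} {p : List ℕ} :
    firsts p = List.range' 1 (K + 1) ↔ ∃ p' v, p = p' ++ (K + 1) :: v ∧
      firsts p' = List.range' 1 K ∧ ∀ x ∈ v, x ∈ Finset.Icc 1 (K + 1) := by
  have hr : List.range' 1 (K + 1) = List.range' 1 K ++ (K + 1) :: [] := by
    rw [List.range'_concat]; simp [add_comm]
  constructor
  · intro h
    have hmem : ∀ x, x ∈ p → x ∈ Finset.Icc 1 (K + 1) := by
      intro x hx
      rw [← mem_firsts, h, List.mem_range'_1] at hx
      rw [Finset.mem_Icc]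
      omega
    have hK : K + 1 ∈ p := by rw [← mem_firsts, h, List.mem_range'_1]; omega
    obtain ⟨p', v, rfl, hp⟩ := List.eq_append_cons_of_mem hK
    rw [firsts_append, firsts, List.filter_cons_of_pos (by simpa using hp), hr] at h
    exact ⟨p', v, rfl, (append_cons_inj_of_notMem_left (by simpa using hp) (by simp; omega) h).1,
      fun x hx => hmem x (by simp [hx])⟩
  · rintro ⟨p', v, rfl, hp, hv⟩
    have hp' : ∀ x, x ∈ p' ↔ 1 ≤ x ∧ x < 1 + K := fun x => by
      rw [← mem_firsts, hp, List.mem_range'_1]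
    rw [firsts_append, firsts, List.filter_cons_of_pos (by simp [hp']; omega), hr, hp]
    congr 2
    simp only [List.filter_filter, List.filter_eq_nil_iff, mem_firsts, hp']
    intro x hx
    have := Finset.mem_Icc.1 (hv x hx)
    simp
    omega

open Classical in
/-- The canonical words of length `i` with letters `1, …, K`. -/
noncomputable def canonicalWords (K i : ℕ) : Finset (List ℕ) :=
  (wordsOver (Finset.Icc 1 K) i).filter fun p => firsts p = List.range' 1 K

theorem mem_canonicalWords {K i : ℕ} {p : List ℕ} :
    p ∈ canonicalWords K i ↔ p.length = i ∧ firsts p = List.range' 1 K := by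
  classical
  simp only [canonicalWords, Finset.mem_filter, mem_wordsOver, and_assoc]
  refine and_congr_right fun _ => and_iff_right_of_imp fun h x hx => ?_
  rw [← mem_firsts, h, List.mem_range'_1] at hx
  rw [Finset.mem_Icc]
  omega

theorem mem_of_mem_canonicalWords {K i : ℕ} {p : List ℕ} (h : p ∈ canonicalWords K i) (x : ℕ) :
    x ∈ p ↔ x ∈ Finset.Icc 1 K := by
  rw [← mem_firsts, (mem_canonicalWords.1 h).2, List.mem_range'_1, Finset.mem_Icc]
  omega

theorem canonicalWords_zero (i : ℕ) : canonicalWords 0 i = if i = 0 then {[]} else ∅ := by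
  ext p
  rw [mem_canonicalWords, List.range'_zero, firsts_eq_nil]
  split_ifs with h
  · simp +contextual [h]
  · simp only [Finset.notMem_empty, iff_false]
    rintro ⟨rfl, rfl⟩
    exact h rfl

theorem sum_canonicalWords_succ (K i : ℕ) (f : List ℕ → ℕ) :
    ∑ p ∈ canonicalWords (K + 1) i, f p = ∑ j ∈ Finset.range i, ∑ p ∈ canonicalWords K j,
      ∑ v ∈ wordsOver (Finset.Icc 1 (K + 1)) (i - 1 - j), f (p ++ (K + 1) :: v) := by
  trans ∑ z ∈ (Finset.range i).sigma fun j =>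
      canonicalWords K j ×ˢ wordsOver (Finset.Icc 1 (K + 1)) (i - 1 - j),
    f (z.2.1 ++ (K + 1) :: z.2.2)
  swap
  · rw [Finset.sum_sigma]
    exact Finset.sum_congr rfl fun j _ =>
      Finset.sum_product' _ _ fun p v => f (p ++ (K + 1) :: v)
  symm
  refine Finset.sum_bij (fun z _ => z.2.1 ++ (K + 1) :: z.2.2) ?_ ?_ ?_ (fun _ _ => rfl)
  · rintro ⟨j, p, v⟩ hz
    simp only [Finset.mem_sigma, Finset.mem_product, Finset.mem_range, mem_canonicalWords,
      mem_wordsOver] at hz ⊢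
    obtain ⟨hj, ⟨h1, h2⟩, h3, h4⟩ := hz
    exact ⟨by simp; omega, firsts_eq_range'_succ.2 ⟨p, v, rfl, h2, h4⟩⟩
  · rintro ⟨j, p, v⟩ hz ⟨j', p', v'⟩ hz' he
    simp only [Finset.mem_sigma, Finset.mem_product] at hz hz'
    have hK : ∀ {l j}, l ∈ canonicalWords K j → K + 1 ∉ l := fun hl => by
      rw [mem_of_mem_canonicalWords hl]; simp
    obtain ⟨rfl, rfl⟩ := append_cons_inj_of_notMem_left (hK hz.2.1) (hK hz'.2.1) he
    have h1 := (mem_canonicalWords.1 hz.2.1).1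
    have h2 := (mem_canonicalWords.1 hz'.2.1).1
    rw [← h1, ← h2]
  · intro p hp
    rw [mem_canonicalWords] at hp
    obtain ⟨p', v, rfl, h1, h2⟩ := firsts_eq_range'_succ.1 hp.2
    have h3 := hp.1
    rw [List.length_append, List.length_cons] at h3
    refine ⟨⟨p'.length, p', v⟩, ?_, rfl⟩
    simp only [Finset.mem_sigma, Finset.mem_product, Finset.mem_range, mem_canonicalWords,
      mem_wordsOver]
    exact ⟨by omega, ⟨trivial, h1⟩, by omega, h2⟩

/-- The effect of introducing the letter `K + 1` on the number of continuations of a canonical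
word with letters `1, …, K`. -/
def SuccRule (G : List ℕ → Prop) : Prop :=
  ∀ K i, ∀ p ∈ canonicalWords K i, ∀ t,
    wordCount (Finset.Icc 1 (K + 1)) (fun u => G (p ++ (K + 1) :: u)) t =
      wordCount (Finset.Icc 1 K) (fun u => G (p ++ u)) t +
        ∑ s ∈ Finset.range t, (s + 1) * wordCount (Finset.Icc 1 K) (fun u => G (p ++ u)) s

theorem SuccRule.sum_succ {G : List ℕ → Prop} (h : SuccRule G) (K i t : ℕ) :
    ∑ p ∈ canonicalWords (K + 1) i, wordCount (Finset.Icc 1 (K + 1)) (fun u => G (p ++ u)) t =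
      ∑ j ∈ Finset.range i,
        (∑ p ∈ canonicalWords K j,
          wordCount (Finset.Icc 1 K) (fun u => G (p ++ u)) (i - 1 - j + t) +
        ∑ s ∈ Finset.range (i - 1 - j + t), (s + 1) *
          ∑ p ∈ canonicalWords K j, wordCount (Finset.Icc 1 K) (fun u => G (p ++ u)) s) := by
  rw [sum_canonicalWords_succ]
  refine Finset.sum_congr rfl fun j _ => ?_
  simp only [Finset.mul_sum]
  rw [Finset.sum_comm (s := Finset.range _), ← Finset.sum_add_distrib]
  refine Finset.sum_congr rfl fun p hp => ?_
  rw [← h K j p hp,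
    ← sum_wordCount_append (Finset.Icc 1 (K + 1)) (fun u => G (p ++ (K + 1) :: u))]
  simp only [List.append_assoc, List.cons_append]

theorem SuccRule.sum_eq {G G' : List ℕ → Prop} (h : SuccRule G) (h' : SuccRule G')
    (h0 : G [] ↔ G' []) (K : ℕ) : ∀ i t,
    ∑ p ∈ canonicalWords K i, wordCount (Finset.Icc 1 K) (fun u => G (p ++ u)) t =
      ∑ p ∈ canonicalWords K i, wordCount (Finset.Icc 1 K) (fun u => G' (p ++ u)) t := by
  induction K with
  | zero =>
    intro i t
    rw [canonicalWords_zero]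
    split_ifs with hi
    · simp only [Finset.sum_singleton, List.nil_append]
      refine wordCount_congr fun l _ hl => ?_
      obtain rfl : l = [] := List.eq_nil_iff_forall_not_mem.2 fun x hx => by simpa using hl x hx
      exact h0
    · simp
  | succ K ih =>
    intro i t
    simp only [h.sum_succ, h'.sum_succ, ih]

open Classical in
theorem SuccRule.card_eq {G G' : List ℕ → Prop} (h : SuccRule G) (h' : SuccRule G')
    (h0 : G [] ↔ G' []) (K i : ℕ) :
    ((canonicalWords K i).filter G).card = ((canonicalWords K i).filter G').card := by
  have hG (G : List ℕ → Prop) : ((canonicalWords K i).filter G).card =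
      ∑ p ∈ canonicalWords K i, wordCount (Finset.Icc 1 K) (fun u => G (p ++ u)) 0 := by
    rw [Finset.card_filter]
    refine Finset.sum_congr rfl fun p _ => ?_
    simp only [wordCount, wordsOver, Finset.filter_singleton, List.append_nil]
    split_ifs <;> rfl
  rw [hG, hG, h.sum_eq h' h0]

theorem Icc_one_succ (K : ℕ) : Finset.Icc 1 (K + 1) = insert (K + 1) (Finset.Icc 1 K) := by
  ext x
  simp only [Finset.mem_insert, Finset.mem_Icc]
  omega

theorem InsertionRule.succRule {τ : ℕ → ℕ → List ℕ} {e : ℕ → ℕ → ℕ → List ℕ → List ℕ}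
    (h : ∀ m, InsertionRule τ m (e m)) (hτ : ∀ a b x, x ∈ τ a b ↔ x = a ∨ x = b) :
    SuccRule (AvoidsPair τ) := by
  intro K i p hp t
  rw [Icc_one_succ]
  exact (h (K + 1)).wordCount_avoidsPair hτ (mem_of_mem_canonicalWords hp)
    (fun x hx => by rw [Finset.mem_Icc] at hx; omega) t

theorem wordCount_reverse (S : Finset ℕ) (P : List ℕ → Prop) (n : ℕ) :
    wordCount S (fun u => P u.reverse) n = wordCount S P n := by
  classical
  unfold wordCount
  refine Finset.card_bij (fun u _ => u.reverse) ?_ ?_ ?_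
  · intro u hu
    simpa [mem_wordsOver] using hu
  · exact fun u _ v _ h => List.reverse_injective h
  · intro u hu
    exact ⟨u.reverse, by simpa [mem_wordsOver] using hu, List.reverse_reverse u⟩

theorem succRule_avoidsAbaab_reverse : SuccRule fun w => AvoidsAbaab w.reverse := by
  intro K i p hp t
  have h := wordCount_avoidsAbaab_cons (L := Finset.Icc 1 K) (q := p.reverse) (m := K + 1)
    (fun x => by rw [List.mem_reverse, mem_of_mem_canonicalWords hp]) (by simp) t
  simp only [List.reverse_append, List.reverse_cons, List.append_assoc, List.singleton_append]
  simp only [← wordCount_reverse _ (fun u => AvoidsAbaab (u ++ _))] at h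
  rw [Icc_one_succ]
  exact h

theorem foldr_max_eq_of_firsts {π : List ℕ} {k : ℕ} (h : firsts π = List.range' 1 k) :
    π.foldr max 0 = k := by
  have hmem : ∀ x, x ∈ π ↔ 1 ≤ x ∧ x < 1 + k := fun x => by
    rw [← mem_firsts, h, List.mem_range'_1]
  apply le_antisymm
  · exact List.max_le_of_forall_le π k fun x hx => by have := (hmem x).1 hx; omega
  · rcases k with _ | k
    · simp
    · exact List.le_max_of_le ((hmem (k + 1)).2 (by omega)) le_rfl

theorem isCanonicalSeq_concat {π : List ℕ} {x : ℕ} :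
    IsCanonicalSeq (π ++ [x]) ↔ IsCanonicalSeq π ∧ 1 ≤ x ∧ x ≤ π.foldr max 0 + 1 := by
  constructor
  · intro h
    refine ⟨fun i hi => ?_, ?_⟩
    · have := h i (by simp; omega)
      simpa [List.getElem_append_left hi, List.take_append_of_le_length hi.le] using this
    · simpa using h π.length (by simp)
  · rintro ⟨h, hx⟩ i hi
    rw [List.length_append, List.length_singleton] at hi
    by_cases hi' : i < π.length
    · simpa [List.getElem_append_left hi', List.take_append_of_le_length hi'.le] using h i hi'
    · obtain rfl : i = π.length := by omega
      simpa using hx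

theorem firsts_concat (π : List ℕ) (x : ℕ) :
    firsts (π ++ [x]) = firsts π ++ if x ∈ π then [] else [x] := by
  rw [firsts_append]
  simp only [firsts, List.filter_nil, List.filter_singleton]
  split_ifs <;> simp_all

theorem isCanonicalSeq_iff_exists_firsts {π : List ℕ} :
    IsCanonicalSeq π ↔ ∃ k, firsts π = List.range' 1 k := by
  induction π using List.reverseRecOn with
  | nil => exact ⟨fun _ => ⟨0, rfl⟩, fun _ i h => by simp at h⟩
  | append_singleton π x ih =>
    rw [isCanonicalSeq_concat, ih, firsts_concat]
    constructor
    · rintro ⟨⟨k, hk⟩, h1, h2⟩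
      rw [foldr_max_eq_of_firsts hk] at h2
      have hx : x ∈ π ↔ 1 ≤ x ∧ x < 1 + k := by rw [← mem_firsts, hk, List.mem_range'_1]
      split_ifs with h
      · exact ⟨k, by simpa using hk⟩
      · obtain rfl : x = 1 + k := by rw [hx] at h; omega
        exact ⟨k + 1, by rw [hk, List.range'_concat, one_mul]⟩
    · rintro ⟨k, hk⟩
      split_ifs at hk with h
      · rw [List.append_nil] at hk
        have hx : 1 ≤ x ∧ x < 1 + k := by rwa [← List.mem_range'_1, ← hk, mem_firsts]
        exact ⟨⟨k, hk⟩, hx.1, by rw [foldr_max_eq_of_firsts hk]; omega⟩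
      · rcases k with _ | k
        · simp at hk
        · rw [List.range'_concat, one_mul] at hk
          obtain ⟨h1, h2⟩ := List.append_inj' hk rfl
          obtain rfl : x = 1 + k := by simpa using h2
          exact ⟨⟨k, h1⟩, by omega, by rw [foldr_max_eq_of_firsts h1]; omega⟩

theorem mem_canonicalWords_iff_isCanonicalSeq {m n : ℕ} {π : List ℕ} :
    π ∈ canonicalWords m n ↔ π.length = n ∧ IsCanonicalSeq π ∧ π.foldr max 0 = m := by
  rw [mem_canonicalWords, isCanonicalSeq_iff_exists_firsts]
  refine and_congr_right fun _ => ⟨fun h => ⟨⟨m, h⟩, foldr_max_eq_of_firsts h⟩, ?_⟩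
  rintro ⟨⟨k, hk⟩, rfl⟩
  rwa [foldr_max_eq_of_firsts hk]

theorem avoidsPat_iff_avoidsPair {π ρ : List ℕ} (hρ : ∀ x ∈ ρ, x = 1 ∨ x = 2) :
    AvoidsPat π (1 :: 2 :: ρ) ↔
      AvoidsPair (fun a b => ρ.map fun i => if i = 1 then a else b) π := by
  have hσ : ∀ i, (1 :: 2 :: ρ).get i = 1 ∨ (1 :: 2 :: ρ).get i = 2 := by
    intro i
    have := List.get_mem (1 :: 2 :: ρ) i
    simp only [List.mem_cons] at this
    rcases this with h | h | h
    exacts [Or.inl h, Or.inr h, hρ _ h]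
  have hmap (a b : ℕ) : (a :: b :: ρ.map fun i => if i = 1 then a else b) =
      (1 :: 2 :: ρ).map fun i => if i = 1 then a else b := by simp
  unfold AvoidsPat AvoidsPair
  rw [← not_iff_not, not_not]
  push Not
  simp only [hmap]
  generalize hs : 1 :: 2 :: ρ = σ at hσ ⊢
  have h0 : 0 < σ.length := by simp [← hs]
  have h1 : 1 < σ.length := by simp [← hs]
  have hg0 : σ.get ⟨0, h0⟩ = 1 := by simp [← hs]
  have hg1 : σ.get ⟨1, h1⟩ = 2 := by simp [← hs]
  constructor
  · rintro ⟨f, hf, h⟩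
    refine ⟨π.get (f ⟨0, h0⟩), π.get (f ⟨1, h1⟩), (h _ _).1 (by omega), ?_⟩
    rw [List.sublist_iff_exists_fin_orderEmbedding_get_eq]
    refine ⟨OrderEmbedding.ofStrictMono (fun i => f (i.cast (List.length_map _)))
      fun i j hij => hf hij, fun i => ?_⟩
    have key : ∀ i j, σ.get i = σ.get j → π.get (f i) = π.get (f j) := fun i j hij => by
      have h2 := h i j
      have h3 := h j i
      omega
    have hi := hσ (i.cast (List.length_map _))
    simp only [List.get_eq_getElem, List.getElem_map, OrderEmbedding.coe_ofStrictMono]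
    split_ifs with h2
    · exact key _ (i.cast (List.length_map _)) (hg0.trans h2.symm)
    · exact key _ (i.cast (List.length_map _)) (hg1.trans (hi.resolve_left h2).symm)
  · rintro ⟨a, b, hab, h⟩
    rw [List.sublist_iff_exists_fin_orderEmbedding_get_eq] at h
    obtain ⟨f, hf⟩ := h
    refine ⟨fun i => f (i.cast (List.length_map _).symm), fun i j hij => f.strictMono hij,
      fun i j => ?_⟩
    rw [← hf, ← hf]
    have hi := hσ i
    have hj := hσ j
    simp only [List.get_eq_getElem, List.getElem_map, Fin.val_cast] at hi hj ⊢
    rcases hi with hi | hi <;> rcases hj with hj | hj <;> simp [hi, hj, hab, hab.le]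

theorem avoidsPair_iff_avoidsAbaab {π : List ℕ} {m : ℕ} (h : firsts π = List.range' 1 m) :
    AvoidsPair (fun a b => [a, a, b]) π ↔ AvoidsAbaab π := by
  have hx : ∀ {x b y}, π = x ++ b :: y → b ∉ x → ∀ a, a ∈ x ↔ 1 ≤ a ∧ a < b := by
    rintro x b y rfl hb a
    have hb' : 1 ≤ b ∧ b < 1 + m := by
      rw [← List.mem_range'_1, ← h, mem_firsts]; simp
    rw [firsts_append, firsts, List.filter_cons_of_pos (by simpa using hb)] at h
    have hm : List.range' 1 m = List.range' 1 (b - 1) ++ b :: List.range' (b + 1) (m - b) := by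
      rw [← List.range'_succ]
      have := List.range'_append_1 (s := 1) (m := b - 1) (n := m - b + 1)
      rw [show 1 + (b - 1) = b by omega, show b - 1 + (m - b + 1) = m by omega] at this
      exact this.symm
    have h1 := (append_cons_inj_of_notMem_left (by simpa using hb) (by simp; omega)
      (h.trans hm)).1
    rw [← mem_firsts, h1, List.mem_range'_1]
    omega
  constructor
  · intro hp x b y a he hb ha hs
    refine hp a b ((hx he hb a).1 ha).2 ?_
    rw [he]
    exact (List.singleton_sublist.2 ha).append (hs.cons_cons b)
  · intro hp a b hab hs
    obtain ⟨x, y, he, hb⟩ := List.eq_append_cons_of_mem (hs.subset (by simp : b ∈ _))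
    have ha : 1 ≤ a := by
      have : a ∈ π := hs.subset (by simp)
      rw [← mem_firsts, h, List.mem_range'_1] at this
      exact this.1
    refine hp x b y a he hb ((hx he hb a).2 ⟨ha, hab⟩) ?_
    rw [he] at hs
    exact List.cons_sublist_cons.1
      (sublist_of_cons_sublist_append hb (List.sublist_of_cons_sublist hs))

theorem firsts_map {f : ℕ → ℕ} {w : List ℕ} (hf : ∀ x ∈ w, ∀ y ∈ w, f x = f y → x = y) :
    firsts (w.map f) = (firsts w).map f := by
  induction w with
  | nil => rfl
  | cons a w ih =>
    simp only [List.map_cons, firsts]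
    rw [ih fun x hx y hy => hf x (by simp [hx]) y (by simp [hy]), List.filter_map]
    congr 2
    apply List.filter_congr
    intro x hx
    rw [mem_firsts] at hx
    have := hf x (by simp [hx]) a (by simp)
    simp only [Function.comp, decide_eq_decide]
    exact ⟨mt (by rintro rfl; rfl), mt this⟩

theorem AvoidsAbaab.map {f : ℕ → ℕ} {w : List ℕ} (h : AvoidsAbaab w)
    (hf : ∀ x ∈ w, ∀ y ∈ w, f x = f y → x = y) : AvoidsAbaab (w.map f) := by
  intro x' b' y' a' he hb ha hs
  obtain ⟨x, z, rfl, rfl, hz⟩ := List.map_eq_append_iff.1 he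
  obtain ⟨b, y, rfl, rfl, rfl⟩ := List.map_eq_cons_iff.1 hz
  obtain ⟨a, hax, rfl⟩ := List.mem_map.1 ha
  obtain ⟨l, hl, he⟩ := List.sublist_map_iff.1 hs
  obtain ⟨c, l, rfl, hc, he⟩ := List.map_eq_cons_iff.1 he.symm
  obtain ⟨d, l, rfl, hd, he⟩ := List.map_eq_cons_iff.1 he
  obtain ⟨e, l, rfl, hfe, hl'⟩ := List.map_eq_cons_iff.1 he
  obtain rfl := List.map_eq_nil_iff.1 hl'
  have hmem : ∀ z ∈ [c, d, e], z ∈ x ++ b :: y := fun z hz => by simp [hl.subset hz]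
  have haw : a ∈ x ++ b :: y := List.mem_append_left _ hax
  obtain rfl := hf c (hmem c (by simp)) a haw hc
  obtain rfl := hf d (hmem d (by simp)) c haw hd
  obtain rfl := hf e (hmem e (by simp)) b (by simp) hfe
  exact h x e y d rfl (fun h => hb (List.mem_map_of_mem h)) hax hl

/-- The position, starting from `1`, of a letter among the first occurrences in `w`. -/
def firstRank (w : List ℕ) (x : ℕ) : ℕ := (firsts w).idxOf x + 1

theorem firstRank_injOn (w : List ℕ) :
    ∀ x ∈ w, ∀ y ∈ w, firstRank w x = firstRank w y → x = y := by
  intro x hx y _ h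
  exact List.idxOf_inj (mem_firsts.2 hx) |>.1 (Nat.succ_injective h)

theorem firstRank_map {f : ℕ → ℕ} {w : List ℕ} (hf : ∀ x ∈ w, ∀ y ∈ w, f x = f y → x = y)
    {x : ℕ} (hx : x ∈ w) : firstRank (w.map f) (f x) = firstRank w x := by
  have key : ∀ l : List ℕ, (∀ y ∈ l, f y = f x → y = x) → (l.map f).idxOf (f x) = l.idxOf x := by
    intro l
    induction l with
    | nil => simp
    | cons y l ih =>
      intro h
      by_cases hy : y = x
      · simp [hy]
      · have hy' : f y ≠ f x := fun e => hy (h y (by simp) e)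
        rw [List.map_cons, List.idxOf_cons_ne _ hy', List.idxOf_cons_ne _ hy,
          ih fun z hz => h z (by simp [hz])]
  rw [firstRank, firsts_map hf, key _ fun y hy => hf y (mem_firsts.1 hy) x hx, firstRank]

/-- The canonical word with the same set partition as `w`. -/
def standardize (w : List ℕ) : List ℕ := w.map (firstRank w)

theorem firsts_standardize (w : List ℕ) :
    firsts (standardize w) = List.range' 1 (firsts w).length := by
  rw [standardize, firsts_map (firstRank_injOn w)]
  refine List.ext_getElem (by simp) fun i h1 h2 => ?_
  rw [List.length_map] at h1
  simp [firstRank, (nodup_firsts w).idxOf_getElem i h1, add_comm]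

theorem standardize_map {f : ℕ → ℕ} {w : List ℕ} (hf : ∀ x ∈ w, ∀ y ∈ w, f x = f y → x = y) :
    standardize (w.map f) = standardize w := by
  rw [standardize, standardize, List.map_map]
  exact List.map_congr_left fun x hx => firstRank_map hf hx

theorem standardize_eq_self {w : List ℕ} {k : ℕ} (h : firsts w = List.range' 1 k) :
    standardize w = w := by
  refine (List.map_congr_left fun x hx => ?_).trans (List.map_id w)
  rw [← mem_firsts, h, List.mem_range'_1] at hx
  have h1 := (List.nodup_range' (s := 1) (n := k)).idxOf_getElem (x - 1) (by simp; omega)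
  rw [List.getElem_range', one_mul, Nat.add_sub_cancel' hx.1] at h1
  rw [firstRank, h, h1, Nat.sub_add_cancel hx.1, id]

theorem standardize_reverse_mem {K i : ℕ} {w : List ℕ} (h : w ∈ canonicalWords K i) :
    standardize w.reverse ∈ canonicalWords K i := by
  rw [mem_canonicalWords] at h ⊢
  refine ⟨by simp [standardize, h.1], ?_⟩
  rw [firsts_standardize]
  congr 1
  have : (firsts w.reverse).Perm (firsts w) :=
    (List.perm_ext_iff_of_nodup (nodup_firsts _) (nodup_firsts _)).2 (by simp)
  rw [this.length_eq, h.2, List.length_range']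

theorem reverse_standardize_reverse (w : List ℕ) :
    (standardize w.reverse).reverse = w.map (firstRank w.reverse) := by
  rw [standardize, ← List.map_reverse, List.reverse_reverse]

theorem firstRank_reverse_injOn (w : List ℕ) :
    ∀ x ∈ w, ∀ y ∈ w, firstRank w.reverse x = firstRank w.reverse y → x = y :=
  fun x hx y hy => firstRank_injOn w.reverse x (by simpa) y (by simpa)

open Classical in
theorem card_filter_avoidsAbaab_reverse (K i : ℕ) :
    ((canonicalWords K i).filter fun w => AvoidsAbaab w.reverse).card =
      ((canonicalWords K i).filter AvoidsAbaab).card := by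
  have hinv : ∀ w ∈ canonicalWords K i,
      standardize (standardize w.reverse).reverse = w := fun w hw => by
    rw [reverse_standardize_reverse, standardize_map (firstRank_reverse_injOn w),
      standardize_eq_self (mem_canonicalWords.1 hw).2]
  refine Finset.card_nbij' (fun w => standardize w.reverse) (fun w => standardize w.reverse)
    ?_ ?_ ?_ ?_
  · intro w hw
    simp only [Finset.coe_filter, Set.mem_ofPred_eq] at hw ⊢
    exact ⟨standardize_reverse_mem hw.1, hw.2.map (firstRank_injOn _)⟩
  · intro w hw
    simp only [Finset.coe_filter, Set.mem_ofPred_eq] at hw ⊢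
    rw [reverse_standardize_reverse]
    exact ⟨standardize_reverse_mem hw.1, hw.2.map (firstRank_reverse_injOn w)⟩
  · exact fun w hw => hinv w (Finset.mem_filter.1 hw).1
  · exact fun w hw => hinv w (Finset.mem_filter.1 hw).1

open Classical in
theorem card_filter_avoidsPat_eq {ρ : List ℕ} (hρ : ∀ x ∈ ρ, x = 1 ∨ x = 2)
    (h : SuccRule (AvoidsPair fun a b => ρ.map fun i => if i = 1 then a else b)) (m n : ℕ) :
    ((canonicalWords m n).filter fun π => AvoidsPat π [1, 2, 1, 1, 2]).card =
      ((canonicalWords m n).filter fun π => AvoidsPat π (1 :: 2 :: ρ)).card := by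
  rw [Finset.filter_congr fun π _ => avoidsPat_iff_avoidsPair hρ,
    h.card_eq succRule_avoidsAbaab_reverse (iff_of_true ?_ ?_), card_filter_avoidsAbaab_reverse]
  · congr 1
    refine Finset.filter_congr fun π hπ => ?_
    rw [avoidsPat_iff_avoidsPair (by simp),
      ← avoidsPair_iff_avoidsAbaab (mem_canonicalWords.1 hπ).2]
    simp
  · intro a b _ hs
    simp at hs
  · intro x b y a he
    simp at he

open Classical in
theorem ncard_canonicalWords_avoidsPat (σ : List ℕ) (n m : ℕ) :
    Set.ncard {π : List ℕ | π.length = n ∧ IsCanonicalSeq π ∧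
      π.foldr max 0 = m ∧ AvoidsPat π σ} =
      ((canonicalWords m n).filter fun π => AvoidsPat π σ).card := by
  rw [← Set.ncard_coe_finset]
  congr 1
  ext π
  simp only [Finset.coe_filter, mem_canonicalWords_iff_isCanonicalSeq, Set.mem_ofPred_eq]
  tauto

theorem length_firsts_le (w : List ℕ) : (firsts w).length ≤ w.length := by
  induction w with
  | nil => simp [firsts]
  | cons a w ih => exact Nat.succ_le_succ ((List.length_filter_le _ _).trans ih)

open Classical in
theorem pAvoid_eq_sum (σ : List ℕ) (n : ℕ) :
    pAvoid n σ = ∑ m ∈ Finset.range (n + 1),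
      ((canonicalWords m n).filter fun π => AvoidsPat π σ).card := by
  rw [← Finset.card_biUnion, pAvoid, ← Set.ncard_coe_finset]
  · congr 1
    ext π
    simp only [Finset.coe_biUnion, Finset.coe_filter, Finset.coe_range, Set.mem_iUnion,
      Set.mem_ofPred_eq, Set.mem_Iio, exists_prop]
    constructor
    · rintro ⟨rfl, h1, h2⟩
      refine ⟨π.foldr max 0, ?_, mem_canonicalWords_iff_isCanonicalSeq.2 ⟨rfl, h1, rfl⟩, h2⟩
      obtain ⟨k, hk⟩ := isCanonicalSeq_iff_exists_firsts.1 h1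
      have := length_firsts_le π
      rw [hk, List.length_range'] at this
      rw [foldr_max_eq_of_firsts hk]
      omega
    · rintro ⟨m, -, h1, h2⟩
      rw [mem_canonicalWords_iff_isCanonicalSeq] at h1
      exact ⟨h1.1, h1.2.1, h2⟩
  · intro i _ j _ hij
    rw [Function.onFun, Finset.disjoint_left]
    intro π hi hj
    rw [Finset.mem_filter, mem_canonicalWords_iff_isCanonicalSeq] at hi hj
    exact hij (hi.1.2.2.symm.trans hj.1.2.2)

theorem patEquiv_of_succRule {ρ : List ℕ} (hρ : ∀ x ∈ ρ, x = 1 ∨ x = 2)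
    (h : SuccRule (AvoidsPair fun a b => ρ.map fun i => if i = 1 then a else b)) :
    PatEquiv [1, 2, 1, 1, 2] (1 :: 2 :: ρ) := by
  intro n
  rw [pAvoid_eq_sum, pAvoid_eq_sum]
  exact Finset.sum_congr rfl fun m _ => card_filter_avoidsPat_eq hρ h m n

/-- For every n and m, the number of 12112-avoiding partitions
of [n] with exactly m blocks equals the number of 12212-avoiding partitions
of [n] with exactly m blocks; in particular 12112 ∼ 12212, and 12112 is also
equivalent to 12221 and to 12122. -/
theorem statement19 :
    (∀ n m : ℕ,
      Set.ncard {π : List ℕ | π.length = n ∧ IsCanonicalSeq π ∧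
        π.foldr max 0 = m ∧ AvoidsPat π [1, 2, 1, 1, 2]} =
      Set.ncard {π : List ℕ | π.length = n ∧ IsCanonicalSeq π ∧
        π.foldr max 0 = m ∧ AvoidsPat π [1, 2, 2, 1, 2]}) ∧
    PatEquiv [1, 2, 1, 1, 2] [1, 2, 2, 1, 2] ∧
    PatEquiv [1, 2, 1, 1, 2] [1, 2, 2, 2, 1] ∧
    PatEquiv [1, 2, 1, 1, 2] [1, 2, 1, 2, 2] := by
  have h212 := InsertionRule.succRule insertionRule_contiguous (by simp)
  have h221 := InsertionRule.succRule insertionRule_last (by simp; tauto)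
  have h122 := InsertionRule.succRule (fun m => (insertionRule_last m).reverse) (by simp)
  refine ⟨fun n m => ?_, patEquiv_of_succRule (by simp) h212,
    patEquiv_of_succRule (by simp) h221, patEquiv_of_succRule (by simp) h122⟩
  rw [ncard_canonicalWords_avoidsPat, ncard_canonicalWords_avoidsPat]
  exact card_filter_avoidsPat_eq (ρ := [2, 1, 2]) (by simp) h212 m n
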